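/- Let W ∼ μ_{v0,A} and, conditional on W=w, let X_0^T be distributed according to the quenched path law of P_w started at v0. Then for every T ≥ 1 the mutual information I(W; X_0^T) := D( law(W, X_0^T) ‖ law(W) ⊗ law(X_0^T) ) (relative entropy with natural logarithm) satisfies I(W; X_0^T) ≤ (2|E| − 1) · log(T+1). -/

import Mathlib

open MeasureTheory Real Filter
open scoped ENNReal NNReal Classical BigOperators

noncomputable section

namespace ERRW

variable {V : Type*} [Fintype V] [DecidableEq V]

/-- Total weight at a vertex: sum of the edge weights over the edges incident to `i`. -/
def vw (G : SimpleGraph V) [DecidableRel G.Adj] (w : Sym2 V → ℝ) (i : V) : ℝ :=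
  ∑ j ∈ G.neighborFinset i, w s(i, j)

/-- Product of a vertex function over the two endpoints of an unordered pair. -/
def sprod (f : V → ℝ) : Sym2 V → ℝ :=
  Sym2.lift ⟨fun i j => f i * f j, fun i j => mul_comm _ _⟩

/-- Sum of a vertex function over the two endpoints of an unordered pair. -/
def ssum (f : V → ℝ) : Sym2 V → ℝ :=
  Sym2.lift ⟨fun i j => f i + f j, fun i j => add_comm _ _⟩

/-- Quenched transition probability `p_{ij}(w) = w_{ij}/w_i`. -/
def qstep (G : SimpleGraph V) [DecidableRel G.Adj] (w : Sym2 V → ℝ) (i j : V) : ℝ :=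
  if G.Adj i j then w s(i, j) / vw G w i else 0

/-- Stationary distribution `π_i(w) = w_i / Σ_v w_v` of the quenched chain. -/
def statDist (G : SimpleGraph V) [DecidableRel G.Adj] (w : Sym2 V → ℝ) (i : V) : ℝ :=
  vw G w i / ∑ v : V, vw G w v

/-- Spanning trees of `G`, as edge sets. -/
def spanningTrees (G : SimpleGraph V) [DecidableRel G.Adj] : Finset (Finset (Sym2 V)) :=
  G.edgeFinset.powerset.filter fun F =>
    (SimpleGraph.fromEdgeSet (F : Set (Sym2 V))).IsTree

/-- Spanning-tree polynomial `τ(w) = Σ_{T} Π_{e ∈ T} w_e`. -/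
def tau (G : SimpleGraph V) [DecidableRel G.Adj] (w : Sym2 V → ℝ) : ℝ :=
  ∑ F ∈ spanningTrees G, ∏ e ∈ F, w e

/-- Vertex parameter `b_v = (B_v + 1 - 𝟙(v = x))/2`. -/
def bwt (G : SimpleGraph V) [DecidableRel G.Adj] (x : V) (B : Sym2 V → ℝ) (v : V) : ℝ :=
  (vw G B v + 1 - if v = x then 1 else 0) / 2

/-- The normalizing constant `Z_{x,B}` of the magic formula. -/
def Znorm (G : SimpleGraph V) [DecidableRel G.Adj] (x : V) (B : Sym2 V → ℝ) : ℝ :=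
  ((∏ e ∈ G.edgeFinset, Real.Gamma (B e)) /
      ∏ v : V, Real.Gamma (bwt G x B v)) *
    Real.pi ^ (((Fintype.card V : ℝ) - 1) / 2) /
    2 ^ ((1 : ℝ) - (Fintype.card V : ℝ) + ∑ e ∈ G.edgeFinset, B e)

/-- The magic-formula density of `μ_{x,B}` with respect to `Π_{e ≠ e0} dw_e`. -/
def magicDensity (G : SimpleGraph V) [DecidableRel G.Adj] (x : V) (B : Sym2 V → ℝ)
    (w : Sym2 V → ℝ) : ℝ :=
  (Znorm G x B)⁻¹ * (vw G w x) ^ ((1 : ℝ) / 2) *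
      (∏ e ∈ G.edgeFinset, w e ^ (B e - 1)) /
      (∏ v : V, (vw G w v) ^ ((vw G B v + 1) / 2)) *
    Real.sqrt (tau G w)

/-- Coordinates indexed by the non-reference edges. -/
abbrev Epin (G : SimpleGraph V) [DecidableRel G.Adj] (e0 : Sym2 V) :=
  {e : Sym2 V // e ∈ G.edgeFinset ∧ e ≠ e0}

/-- Extension of non-reference edge coordinates to a pinned environment (`w_{e0} = 1`). -/
def pinExt (G : SimpleGraph V) [DecidableRel G.Adj] (e0 : Sym2 V)
    (u : Epin G e0 → ℝ) : Sym2 V → ℝ :=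
  fun e => if e = e0 then 1 else if h : e ∈ G.edgeFinset ∧ e ≠ e0 then u ⟨e, h⟩ else 0

/-- The mixing measure `μ_{x,B}` of the magic formula, as a measure on
environments pinned at the reference edge `e0`. -/
def mixing (G : SimpleGraph V) [DecidableRel G.Adj] (e0 : Sym2 V) (x : V) (B : Sym2 V → ℝ) :
    Measure (Sym2 V → ℝ) :=
  Measure.map (pinExt G e0)
    ((volume : Measure (Epin G e0 → ℝ)).withDensity fun u =>
      ENNReal.ofReal
        (if ∀ e ∈ G.edgeFinset, 0 < pinExt G e0 u e then
          magicDensity G x B (pinExt G e0 u) else 0))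

/-- Kullback–Leibler divergence (natural logarithm), `+∞` if `P` is not
absolutely continuous with respect to `Q`. -/
def KL {Ω : Type*} [MeasurableSpace Ω] (P Q : Measure Ω) : EReal :=
  if P ≪ Q then ((∫ x, Real.log (P.rnDeriv Q x).toReal ∂P : ℝ) : EReal) else ⊤

/-- Edge local time (current edge weight) at time `t` along a path. -/
def localTime (a : Sym2 V → ℝ) (x : ℕ → V) (t : ℕ) (e : Sym2 V) : ℝ :=
  a e + ((Finset.range t).filter fun k => s(x k, x (k + 1)) = e).card

/-- One-step ERRW conditional probability at time `t` given the past of the path. -/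
def errwStep (G : SimpleGraph V) [DecidableRel G.Adj] (a : Sym2 V → ℝ) (x : ℕ → V)
    (t : ℕ) : ℝ :=
  if G.Adj (x t) (x (t + 1)) then
    localTime a x t s(x t, x (t + 1)) /
      ∑ u ∈ G.neighborFinset (x t), localTime a x t s(x t, u)
  else 0

/-- Extension of a finite path to ℕ (junk value `v0` beyond time `T`). -/
def extendPath {T : ℕ} (v0 : V) (x : Fin (T + 1) → V) : ℕ → V :=
  fun t => if h : t < T + 1 then x ⟨t, h⟩ else v0

/-- ERRW trajectory probability of a length-`T` path (the trajectory law mass function). -/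
def errwProb (G : SimpleGraph V) [DecidableRel G.Adj] (v0 : V) (a : Sym2 V → ℝ) (T : ℕ)
    (x : Fin (T + 1) → V) : ℝ :=
  if x 0 = v0 then ∏ t ∈ Finset.range T, errwStep G a (extendPath v0 x) t else 0

/-- Undirected traversal count `N_e` of an edge along a finite path. -/
def edgeCount {T : ℕ} (v0 : V) (x : Fin (T + 1) → V) (e : Sym2 V) : ℕ :=
  ((Finset.range T).filter fun k =>
    s(extendPath v0 x k, extendPath v0 x (k + 1)) = e).card

/-- Quenched path probability of a length-`T` path started at `v0`. -/
def quenchedProb (G : SimpleGraph V) [DecidableRel G.Adj] (v0 : V) (w : Sym2 V → ℝ) (T : ℕ)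
    (x : Fin (T + 1) → V) : ℝ :=
  if x 0 = v0 then
    ∏ t ∈ Finset.range T, qstep G w (extendPath v0 x t) (extendPath v0 x (t + 1))
  else 0

/-- The measure on a finite type determined by a mass function. -/
def discreteMeasure {Ω : Type*} [Fintype Ω] [MeasurableSpace Ω] (p : Ω → ℝ) : Measure Ω :=
  ∑ x : Ω, ENNReal.ofReal (p x) • Measure.dirac x

/-- Digamma function `Ψ = (log Γ)'`. -/
def digamma (x : ℝ) : ℝ := deriv (fun y => Real.log (Real.Gamma y)) x

/-- Trigamma function `Ψ₁ = Ψ'`. -/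
def trigamma (x : ℝ) : ℝ := deriv digamma x

/-- `Λ(p,q) = log Γ(q) − log Γ(p) − (q−p)·Ψ(p)`. -/
def Lam (p q : ℝ) : ℝ :=
  Real.log (Real.Gamma q) - Real.log (Real.Gamma p) - (q - p) * digamma p

set_option linter.unusedSectionVars false

lemma lintegral_Ioi_eq_lintegral_exp (g : ℝ → ℝ≥0∞) :
    ∫⁻ x in Set.Ioi (0 : ℝ), g x = ∫⁻ t : ℝ, ENNReal.ofReal (exp t) * g (exp t) := by
  have h := lintegral_image_eq_lintegral_abs_deriv_mul (s := Set.univ) (f := exp) (f' := exp)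
    MeasurableSet.univ (fun x _ => (Real.hasDerivAt_exp x).hasDerivWithinAt)
    exp_injective.injOn g
  simpa [Set.image_univ, Real.range_exp, abs_of_pos (exp_pos _)] using h

lemma lintegral_exp_mul_sub_exp {p c : ℝ} (hp : 0 < p) (hc : 0 < c) :
    ∫⁻ s : ℝ, ENNReal.ofReal (exp (p * s - c * exp s)) =
      ENNReal.ofReal (Gamma p * (c ^ p)⁻¹) := by
  have h := lintegral_Ioi_eq_lintegral_exp
    fun x => ENNReal.ofReal (x ^ (p - 1) * exp (-(c * x)))
  have hpos : ∀ x ∈ Set.Ioi (0 : ℝ), 0 ≤ x ^ (p - 1) * exp (-(c * x)) := fun x hx => by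
    have : 0 < x := hx
    positivity
  rw [← ofReal_integral_eq_lintegral_ofReal] at h
  · rw [Real.integral_rpow_mul_exp_neg_mul_Ioi hp hc] at h
    rw [show Gamma p * (c ^ p)⁻¹ = (1 / c) ^ p * Gamma p by
      rw [one_div, Real.inv_rpow hc.le, mul_comm], h]
    refine lintegral_congr fun t => ?_
    rw [← ENNReal.ofReal_mul (exp_pos _).le, ← Real.exp_mul, ← exp_add, ← exp_add]
    congr 2
    ring
  · have := Real.integral_rpow_mul_exp_neg_mul_Ioi hp hc
    by_contra hni
    rw [integral_undef hni] at this
    have h1 : 0 < (1 / c) ^ p * Gamma p := mul_pos (by positivity) (Gamma_pos_of_pos hp)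
    exact h1.ne this
  · exact (ae_restrict_iff' measurableSet_Ioi).2 (.of_forall hpos)

lemma lintegral_exp_neg_two_mul_sub_exp {p c : ℝ} (hp : 0 < p) (hc : 0 < c) :
    ∫⁻ u : ℝ, ENNReal.ofReal (exp (-(2 * p * u) - c * exp (-(2 * u)))) =
      ENNReal.ofReal (Gamma p * (c ^ p)⁻¹ / 2) := by
  have h := lintegral_map (μ := volume) (g := fun x : ℝ => (-2) * x)
    (f := fun s => ENNReal.ofReal (exp (p * s - c * exp s))) (by fun_prop) (by fun_prop)
  rw [Real.map_volume_mul_left (by norm_num), lintegral_smul_measure,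
    lintegral_exp_mul_sub_exp hp hc] at h
  rw [show Gamma p * (c ^ p)⁻¹ / 2 = |(-2 : ℝ)⁻¹| * (Gamma p * (c ^ p)⁻¹) by
    rw [abs_inv, abs_neg, abs_two]; ring, ENNReal.ofReal_mul (abs_nonneg _)]
  rw [smul_eq_mul] at h
  rw [h]
  refine lintegral_congr fun u => ?_
  congr 2
  ring_nf

lemma lintegral_gaussian : ∫⁻ z : ℝ, ENNReal.ofReal (exp (-(z ^ 2 / 2))) =
    ENNReal.ofReal √(2 * π) := by
  have h := integral_gaussian (1 / 2)
  rw [show π / (1 / 2) = 2 * π by ring] at h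
  rw [← h, ofReal_integral_eq_lintegral_ofReal (integrable_exp_neg_mul_sq (by norm_num))
    (.of_forall fun _ => (exp_pos _).le)]
  refine lintegral_congr fun z => ?_
  congr 2
  ring

/-- The inverse-Gaussian integral in logarithmic coordinates. -/
lemma lintegral_inverseGaussian {B : ℝ} (hB : 0 < B) :
    ∫⁻ v : ℝ, ENNReal.ofReal (exp (v / 2 - exp v / 2 - B ^ 2 * exp (-v) / 2)) =
      ENNReal.ofReal (√(2 * π) * exp (-B)) := by
  set f : ℝ → ℝ := fun v => exp (v / 2) - B * exp (-v / 2)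
  set f' : ℝ → ℝ := fun v => (exp (v / 2) + B * exp (-v / 2)) / 2
  have hf' : ∀ v, HasDerivAt f (f' v) v := fun v => by
    have h1 := ((hasDerivAt_id v).div_const 2).exp
    have h2 := (((hasDerivAt_id v).neg.div_const 2).exp).const_mul B
    exact (h1.sub h2).congr_deriv (by simp only [f', id, Pi.neg_apply]; ring)
  have hpos : ∀ v, 0 < f' v := fun v => by positivity
  have hmono : StrictMono f := strictMono_of_deriv_pos fun v => by
    rw [(hf' v).deriv]; exact hpos v
  have h := lintegral_image_eq_lintegral_abs_deriv_mul (s := Set.univ) (f := f) (f' := f')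
    MeasurableSet.univ (fun x _ => (hf' x).hasDerivWithinAt) hmono.injective.injOn
    (fun z => ENNReal.ofReal (exp (-(z ^ 2 / 2))))
  have hcont : Continuous f := by fun_prop
  have hsurj : Function.Surjective f := by
    refine hcont.surjective ?_ ?_
    · have h1 : Tendsto (fun v : ℝ => exp (v / 2)) atTop atTop :=
        tendsto_exp_atTop.comp (tendsto_id.atTop_div_const two_pos)
      refine tendsto_atTop_mono' _ ?_ (tendsto_atTop_add_const_right _ (-B) h1)
      filter_upwards [eventually_ge_atTop 0] with v hv
      have : exp (-v / 2) ≤ 1 := exp_le_one_iff.2 (by linarith)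
      simp only [f]
      nlinarith
    · have h1 : Tendsto (fun v : ℝ => B * exp (-v / 2)) atBot atTop :=
        ((tendsto_exp_atTop.comp
          ((tendsto_neg_atBot_atTop).atTop_div_const two_pos))).const_mul_atTop hB
      have h2 := tendsto_atBot_add_const_left _ 1 (tendsto_neg_atTop_atBot.comp h1)
      refine tendsto_atBot_mono' _ ?_ h2
      filter_upwards [eventually_le_atBot 0] with v hv
      have : exp (v / 2) ≤ 1 := exp_le_one_iff.2 (by linarith)
      simp only [f, Function.comp]
      linarith
  rw [Set.image_univ, hsurj.range_eq, Measure.restrict_univ, lintegral_gaussian] at h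
  -- the reflection `v ↦ 2 log B - v` exchanges the two halves of the integrand
  set I := ∫⁻ v : ℝ, ENNReal.ofReal (exp (v / 2 - exp v / 2 - B ^ 2 * exp (-v) / 2))
  have hrefl : I = ∫⁻ v : ℝ, ENNReal.ofReal
      (B * exp (-v / 2) * exp (-exp v / 2 - B ^ 2 * exp (-v) / 2)) := by
    rw [← lintegral_sub_left_eq_self _ (2 * log B)]
    refine lintegral_congr fun v => ?_
    have e1 : exp (2 * log B - v) = B ^ 2 * exp (-v) := by
      rw [sub_eq_add_neg, exp_add, show 2 * log B = log B + log B by ring, exp_add, exp_log hB]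
      ring
    have e2 : B ^ 2 * exp (-(2 * log B - v)) = exp v := by
      rw [neg_sub, sub_eq_add_neg, exp_add, exp_neg (2 * log B),
        show 2 * log B = log B + log B by ring, exp_add, exp_log hB]
      field_simp
    have e3 : B * exp (-(2 * log B - v) / 2) = exp (v / 2) := by
      rw [show -(2 * log B - v) / 2 = v / 2 + -log B by ring, exp_add, exp_neg, exp_log hB]
      field_simp
    congr 1
    have e4 : exp (v / 2 - exp v / 2 - B ^ 2 * exp (-v) / 2) =
        exp (v / 2) * exp (-exp v / 2 - B ^ 2 * exp (-v) / 2) := by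
      rw [← exp_add]; ring_nf
    rw [e4, e1, e2, e3]
    ring_nf
  have hI : I = ENNReal.ofReal (exp (-B)) * ENNReal.ofReal √(2 * π) := by
    have h2 : 2 * I = 2 * (ENNReal.ofReal (exp (-B)) * ENNReal.ofReal √(2 * π)) := by
      nth_rewrite 1 [two_mul]
      nth_rewrite 2 [hrefl]
      rw [← lintegral_add_left (by fun_prop), h, ← lintegral_const_mul' _ _ (by simp),
        ← lintegral_const_mul' _ _ (by simp)]
      refine lintegral_congr fun v => ?_
      rw [← ENNReal.ofReal_add (by positivity) (by positivity), abs_of_pos (hpos v),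
        ← ENNReal.ofReal_mul (hpos v).le, ← ENNReal.ofReal_mul (by positivity),
        ← ENNReal.ofReal_ofNat, ← ENNReal.ofReal_mul (by positivity)]
      congr 1
      have e1 : exp (v / 2) * exp (v / 2) = exp v := by rw [← exp_add]; ring_nf
      have e2 : exp (-v / 2) * exp (-v / 2) = exp (-v) := by rw [← exp_add]; ring_nf
      have e3 : exp (v / 2) * exp (-v / 2) = 1 := by rw [← exp_add]; ring_nf; simp
      have e4 : exp (-B) * exp (-(f v ^ 2 / 2)) = exp (-exp v / 2 - B ^ 2 * exp (-v) / 2) := by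
        rw [← exp_add]
        congr 1
        simp only [f]
        linear_combination -e1 / 2 - B ^ 2 * e2 / 2 + B * e3
      have e5 : exp (v / 2 - exp v / 2 - B ^ 2 * exp (-v) / 2) =
          exp (v / 2) * exp (-exp v / 2 - B ^ 2 * exp (-v) / 2) := by
        rw [← exp_add]; ring_nf
      rw [e5, ← e4]
      simp only [f']
      ring
    exact (ENNReal.mul_right_inj (by norm_num) (by norm_num)).1 h2
  rw [hI, ← ENNReal.ofReal_mul (exp_pos _).le, mul_comm]

lemma lintegral_pi_ofReal_prod {ι : Type*} [Fintype ι] (f : ι → ℝ → ℝ) (c : ι → ℝ)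
    (hm : ∀ i, Measurable (f i)) (hf : ∀ i x, 0 ≤ f i x) (hc : ∀ i, 0 ≤ c i)
    (h : ∀ i, ∫⁻ x, ENNReal.ofReal (f i x) = ENNReal.ofReal (c i)) :
    ∫⁻ x : ι → ℝ, ENNReal.ofReal (∏ i, f i (x i)) = ENNReal.ofReal (∏ i, c i) := by
  have hgi : ∀ i, Integrable (f i) := fun i =>
    ⟨(hm i).aestronglyMeasurable, by
      rw [hasFiniteIntegral_iff_ofReal (.of_forall (hf i)), h i]
      exact ENNReal.ofReal_lt_top⟩
  have hprod : Integrable fun x : ι → ℝ => ∏ i, f i (x i) := Integrable.fintype_prod hgi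
  rw [← ofReal_integral_eq_lintegral_ofReal hprod
    (.of_forall fun x => Finset.prod_nonneg fun i _ => hf i (x i)),
    integral_fintype_prod_volume_eq_prod]
  congr 1
  refine Finset.prod_congr rfl fun i _ => ?_
  rw [integral_eq_lintegral_of_nonneg_ae (.of_forall (hf i)) (hm i).aestronglyMeasurable, h i,
    ENNReal.toReal_ofReal (hc i)]

lemma lintegral_pi_pos_eq_lintegral_exp {ι : Type*} [Fintype ι] (g : (ι → ℝ) → ℝ≥0∞) :
    ∫⁻ x in {x : ι → ℝ | ∀ i, 0 < x i}, g x =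
      ∫⁻ t : ι → ℝ, ENNReal.ofReal (∏ i, exp (t i)) * g (fun i => exp (t i)) := by
  set f' : (ι → ℝ) → (ι → ℝ) →L[ℝ] (ι → ℝ) := fun t => ContinuousLinearMap.pi fun i =>
    (exp (t i) • ContinuousLinearMap.id ℝ ℝ) ∘SL ContinuousLinearMap.proj i
  have hf : ∀ t : ι → ℝ, HasFDerivAt (fun (t : ι → ℝ) i => exp (t i)) (f' t) t := fun t => by
    refine hasFDerivAt_pi.2 fun i => ?_
    have := (hasFDerivAt_apply (𝕜 := ℝ) i t).exp
    exact this.congr_fderiv (by ext; simp)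
  have h := lintegral_image_eq_lintegral_abs_det_fderiv_mul (volume : Measure (ι → ℝ))
    (s := Set.univ) (f := fun t i => exp (t i)) (f' := f') MeasurableSet.univ
    (fun x _ => (hf x).hasFDerivWithinAt)
    (fun x _ y _ hxy => funext fun i => exp_injective (congrFun hxy i)) g
  have himage : Set.image (fun (t : ι → ℝ) i => exp (t i)) Set.univ = {x : ι → ℝ | ∀ i, 0 < x i} := by
    ext x
    simp only [Set.image_univ, Set.mem_range, Set.mem_ofPred_eq]
    exact ⟨by rintro ⟨t, rfl⟩ i; exact exp_pos _,
      fun hx => ⟨fun i => log (x i), funext fun i => exp_log (hx i)⟩⟩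
  rw [himage, Measure.restrict_univ] at h
  rw [h]
  refine lintegral_congr fun t => ?_
  congr 2
  rw [ContinuousLinearMap.det_pi, abs_of_nonneg]
  · simp
  · exact Finset.prod_nonneg fun i _ => by simp [(exp_pos _).le]

/-- The diagonal entry making `ψ = exp u` satisfy `(diag X - W) ψ = κ`. -/
def schrodDiag {ι : Type*} [Fintype ι] (W : Matrix ι ι ℝ) (κ u : ι → ℝ) (i : ι) : ℝ :=
  (κ i + ∑ j, W i j * exp (u j)) * exp (-u i)

/-- Unnormalized density, in the coordinates `u = log ψ`, of the field of a vertex-reinforced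
jump process with conductances `W` and conductances `κ` to the root. -/
def fieldDensity {ι : Type*} [Fintype ι] [DecidableEq ι] (W : Matrix ι ι ℝ) (κ u : ι → ℝ) : ℝ :=
  √(Matrix.diagonal (schrodDiag W κ u) - W).det *
    exp (-(∑ i, schrodDiag W κ u i + ∑ i, κ i * exp (u i)) / 2)

lemma continuous_schrodDiag {ι X : Type*} [Fintype ι] [TopologicalSpace X]
    {W : X → Matrix ι ι ℝ} {κ u : X → ι → ℝ} (hW : Continuous W) (hκ : Continuous κ)
    (hu : Continuous u) : Continuous fun x => schrodDiag (W x) (κ x) (u x) := by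
  have h1 : ∀ i j, Continuous fun x => W x i j := fun i j => hW.matrix_elem i j
  have h2 : ∀ i, Continuous fun x => κ x i := fun i => (continuous_apply i).comp hκ
  have h3 : ∀ i, Continuous fun x => u x i := fun i => (continuous_apply i).comp hu
  refine continuous_pi fun i => ?_
  unfold schrodDiag
  fun_prop

lemma continuous_fieldDensity {ι X : Type*} [Fintype ι] [DecidableEq ι] [TopologicalSpace X]
    {W : X → Matrix ι ι ℝ} {κ u : X → ι → ℝ} (hW : Continuous W) (hκ : Continuous κ)
    (hu : Continuous u) : Continuous fun x => fieldDensity (W x) (κ x) (u x) := by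
  have h := continuous_schrodDiag hW hκ hu
  have h2 : ∀ i, Continuous fun x => κ x i := fun i => (continuous_apply i).comp hκ
  have h3 : ∀ i, Continuous fun x => u x i := fun i => (continuous_apply i).comp hu
  have h4 : ∀ i, Continuous fun x => schrodDiag (W x) (κ x) (u x) i :=
    fun i => (continuous_apply i).comp h
  have h5 := (h.matrix_diagonal.sub hW).matrix_det
  unfold fieldDensity
  fun_prop

lemma det_succ_eq_mul_det_schur {n : ℕ} (M : Matrix (Fin (n + 1)) (Fin (n + 1)) ℝ)
    (h : M 0 0 ≠ 0) :
    M.det = M 0 0 *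
      (Matrix.of fun i j : Fin n => M i.succ j.succ - M i.succ 0 * M 0 j.succ / M 0 0).det := by
  set B : Matrix (Fin (n + 1)) (Fin (n + 1)) ℝ := Matrix.of fun i j =>
    M i j - (if i = 0 then 0 else M i 0 / M 0 0) * M 0 j
  rw [Matrix.det_eq_of_forall_row_eq_smul_add_const (A := M) (B := B)
    (fun i => if i = 0 then 0 else M i 0 / M 0 0) 0 (by simp)
    (fun i j => by simp [B])]
  rw [Matrix.det_succ_column_zero, Fin.sum_univ_succ, Finset.sum_eq_zero]
  · simp only [Fin.val_zero, pow_zero, one_mul, add_zero]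
    congr 1
    · simp [B]
    · congr 1
      ext i j
      simp [B, Matrix.submatrix, Fin.succ_ne_zero]
      ring
  · intro i _
    simp [B, Fin.succ_ne_zero, h]

lemma fieldDensity_cons {n : ℕ} (W : Matrix (Fin (n + 1)) (Fin (n + 1)) ℝ)
    (κ : Fin (n + 1) → ℝ) (hsymm : ∀ i j, W i j = W j i) (u : Fin n → ℝ) (z : ℝ)
    (hb : 0 < κ 0 + ∑ j : Fin n, W 0 j.succ * exp (u j)) :
    fieldDensity W κ
        (Fin.cons (log (κ 0 + ∑ j : Fin n, W 0 j.succ * exp (u j)) - z) u) =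
      exp (z / 2 - exp z / 2 - κ 0 ^ 2 * exp (-z) / 2 - W 0 0 / 2) *
        fieldDensity
          (Matrix.of fun i j : Fin n => W i.succ j.succ + W 0 i.succ * W 0 j.succ * exp (-z))
          (fun i => κ i.succ + W 0 i.succ * κ 0 * exp (-z)) u := by
  set b := κ 0 + ∑ j : Fin n, W 0 j.succ * exp (u j) with hbdef
  set W' : Matrix (Fin n) (Fin n) ℝ :=
    Matrix.of fun i j => W i.succ j.succ + W 0 i.succ * W 0 j.succ * exp (-z)
  set κ' : Fin n → ℝ := fun i => κ i.succ + W 0 i.succ * κ 0 * exp (-z)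
  set U : Fin (n + 1) → ℝ := Fin.cons (log b - z) u
  have hU0 : exp (U 0) = b * exp (-z) := by
    simp only [U, Fin.cons_zero]
    rw [sub_eq_add_neg, exp_add, exp_log hb]
  have hU0' : exp (-U 0) = b⁻¹ * exp z := by
    rw [exp_neg, hU0, mul_inv, ← exp_neg, neg_neg]
  have hUs : ∀ i : Fin n, U i.succ = u i := fun i => by simp [U]
  have hX0 : schrodDiag W κ U 0 = W 0 0 + exp z := by
    unfold schrodDiag
    rw [Fin.sum_univ_succ]
    simp only [hUs]
    rw [show κ 0 + (W 0 0 * exp (U 0) + ∑ j : Fin n, W 0 j.succ * exp (u j)) =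
      W 0 0 * exp (U 0) + b by rw [hbdef]; ring, add_mul, mul_assoc, ← exp_add, hU0']
    simp only [add_neg_cancel, exp_zero, mul_one]
    field_simp
  have hXs : ∀ i : Fin n, schrodDiag W κ U i.succ = schrodDiag W' κ' u i := fun i => by
    unfold schrodDiag
    rw [Fin.sum_univ_succ]
    simp only [hUs, hU0, W', κ', Matrix.of_apply, add_mul, Finset.sum_add_distrib]
    rw [hsymm i.succ 0, hbdef]
    have : ∑ j : Fin n, W 0 i.succ * W 0 j.succ * exp (-z) * exp (u j) =
        W 0 i.succ * exp (-z) * ∑ j : Fin n, W 0 j.succ * exp (u j) := by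
      rw [Finset.mul_sum]
      exact Finset.sum_congr rfl fun j _ => by ring
    rw [this]
    ring
  have hdet : (Matrix.diagonal (schrodDiag W κ U) - W).det =
      exp z * (Matrix.diagonal (schrodDiag W' κ' u) - W').det := by
    have h00 : (Matrix.diagonal (schrodDiag W κ U) - W) 0 0 = exp z := by
      simp [hX0]
    rw [det_succ_eq_mul_det_schur _ (by rw [h00]; exact (exp_pos z).ne'), h00]
    congr 2
    ext i j
    by_cases hij : i = j
    · subst hij
      simp [W', hXs, hsymm i.succ 0, exp_neg, Fin.succ_ne_zero, (Fin.succ_ne_zero _).symm]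
      ring
    · simp [W', hsymm i.succ 0, exp_neg, Fin.succ_ne_zero, (Fin.succ_ne_zero _).symm, hij]
      ring
  have hκ : ∑ i, κ i * exp (U i) = κ 0 ^ 2 * exp (-z) + ∑ i, κ' i * exp (u i) := by
    rw [Fin.sum_univ_succ, hU0]
    simp only [hUs, κ', add_mul, Finset.sum_add_distrib]
    have : ∑ j : Fin n, W 0 j.succ * κ 0 * exp (-z) * exp (u j) =
        κ 0 * exp (-z) * ∑ j : Fin n, W 0 j.succ * exp (u j) := by
      rw [Finset.mul_sum]
      exact Finset.sum_congr rfl fun j _ => by ring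
    rw [this, hbdef]
    ring
  unfold fieldDensity
  rw [hdet, hκ, Fin.sum_univ_succ, hX0, Real.sqrt_mul (exp_pos z).le, ← Real.exp_half]
  simp only [hXs]
  rw [mul_assoc, mul_left_comm, ← exp_add, mul_left_comm, ← exp_add]
  congr 2
  ring

lemma lintegral_fieldDensity_le_fin {n : ℕ} (W : Matrix (Fin n) (Fin n) ℝ) (κ : Fin n → ℝ)
    (hsymm : ∀ i j, W i j = W j i) (hW : ∀ i j, 0 ≤ W i j) (hκ : ∀ i, 0 ≤ κ i) :
    ∫⁻ u, ENNReal.ofReal (fieldDensity W κ u) ≤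
      ENNReal.ofReal (√(2 * π) ^ n * exp (-((∑ i, ∑ j, W i j) / 2 + ∑ i, κ i))) := by
  induction n with
  | zero =>
    rw [volume_pi, Measure.pi_of_empty _ (0 : Fin 0 → ℝ)]
    simp [fieldDensity]
  | succ n ih =>
    set B := κ 0 + ∑ j : Fin n, W 0 j.succ
    have hBnn : 0 ≤ B := add_nonneg (hκ 0) (Finset.sum_nonneg fun j _ => hW _ _)
    rcases hBnn.eq_or_lt with hB | hB
    · have hκ0 : κ 0 = 0 := by
        have : 0 ≤ ∑ j : Fin n, W 0 j.succ := Finset.sum_nonneg fun j _ => hW _ _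
        linarith [hκ 0]
      have hs : ∑ j : Fin n, W 0 j.succ = 0 := by simp only [B] at hB; linarith
      have hc : ∀ j : Fin n, W 0 j.succ = 0 := fun j =>
        (Finset.sum_eq_zero_iff_of_nonneg fun j _ => hW _ _).1 hs j (Finset.mem_univ _)
      have hzero : ∀ u, fieldDensity W κ u = 0 := fun u => by
        unfold fieldDensity
        rw [Matrix.det_eq_zero_of_row_eq_zero 0 fun j => ?_]
        · simp
        · refine Fin.cases ?_ (fun j => ?_) j
          · simp only [Matrix.sub_apply, Matrix.diagonal_apply_eq, schrodDiag,
              Fin.sum_univ_succ, hκ0, hc]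
            simp [mul_assoc, ← exp_add]
          · simp [hc, (Fin.succ_ne_zero _).symm]
      simp [hzero]
    have hb : ∀ u : Fin n → ℝ, 0 < κ 0 + ∑ j : Fin n, W 0 j.succ * exp (u j) := fun u => by
      by_contra hneg
      have hs : 0 ≤ ∑ j : Fin n, W 0 j.succ * exp (u j) :=
        Finset.sum_nonneg fun j _ => mul_nonneg (hW _ _) (exp_pos _).le
      have hκ0 : κ 0 = 0 := by linarith [hκ 0]
      have hs0 : ∑ j : Fin n, W 0 j.succ * exp (u j) = 0 := by linarith [hκ 0]
      rw [Finset.sum_eq_zero_iff_of_nonneg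
        fun j _ => mul_nonneg (hW _ _) (exp_pos _).le] at hs0
      refine hB.ne' ?_
      simp only [B, hκ0, zero_add]
      exact Finset.sum_eq_zero fun j hj =>
        (mul_eq_zero.1 (hs0 j hj)).resolve_right (exp_pos _).ne'
    have hmp := (volume_preserving_piFinSuccAbove (fun _ : Fin (n + 1) => ℝ) 0).symm
    rw [← hmp.lintegral_comp_emb (MeasurableEquiv.measurableEmbedding _)]
    set W' : ℝ → Matrix (Fin n) (Fin n) ℝ := fun z =>
      Matrix.of fun i j => W i.succ j.succ + W 0 i.succ * W 0 j.succ * exp (-z)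
    set κ' : ℝ → Fin n → ℝ := fun z i => κ i.succ + W 0 i.succ * κ 0 * exp (-z)
    set E : ℝ → ℝ := fun z => exp (z / 2 - exp z / 2 - κ 0 ^ 2 * exp (-z) / 2 - W 0 0 / 2)
    have hcW : Continuous W' := continuous_matrix fun i j => by
      simp only [W', Matrix.of_apply]; fun_prop
    have hcκ : Continuous κ' := continuous_pi fun i => by simp only [κ']; fun_prop
    have hcE : Continuous E := by fun_prop
    have hcF : Continuous fun p : (Fin n → ℝ) × ℝ => fieldDensity (W' p.2) (κ' p.2) p.1 :=
      continuous_fieldDensity (hcW.comp continuous_snd) (hcκ.comp continuous_snd) continuous_fst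
    have hcF0 : Continuous fun p : ℝ × (Fin n → ℝ) =>
        fieldDensity W κ (Fin.cons p.1 p.2 : Fin (n + 1) → ℝ) :=
      continuous_fieldDensity continuous_const continuous_const
        (Continuous.finCons continuous_fst continuous_snd)
    calc ∫⁻ p : ℝ × (Fin n → ℝ), ENNReal.ofReal (fieldDensity W κ
          ((MeasurableEquiv.piFinSuccAbove (fun _ : Fin (n + 1) => ℝ) 0).symm p))
        = ∫⁻ p : ℝ × (Fin n → ℝ), ENNReal.ofReal (fieldDensity W κ
          (Fin.cons p.1 p.2 : Fin (n + 1) → ℝ)) := by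
          refine lintegral_congr fun p => ?_
          congr 2
          exact Fin.insertNth_zero' _ _
      _ = ∫⁻ u : Fin n → ℝ, ∫⁻ v : ℝ, ENNReal.ofReal (fieldDensity W κ
          (Fin.cons v u : Fin (n + 1) → ℝ)) := by
          have hm : Measurable fun p : ℝ × (Fin n → ℝ) => ENNReal.ofReal
              (fieldDensity W κ (Fin.cons p.1 p.2 : Fin (n + 1) → ℝ)) :=
            ENNReal.measurable_ofReal.comp hcF0.measurable
          rw [Measure.volume_eq_prod, lintegral_prod_symm' _ hm]
      _ = ∫⁻ u : Fin n → ℝ, ∫⁻ z : ℝ, ENNReal.ofReal (E z) *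
          ENNReal.ofReal (fieldDensity (W' z) (κ' z) u) := by
          refine lintegral_congr fun u => ?_
          rw [← lintegral_sub_left_eq_self _
            (log (κ 0 + ∑ j : Fin n, W 0 j.succ * exp (u j)))]
          refine lintegral_congr fun z => ?_
          rw [fieldDensity_cons W κ hsymm u z (hb u), ENNReal.ofReal_mul (exp_pos _).le]
      _ = ∫⁻ z : ℝ, ∫⁻ u : Fin n → ℝ, ENNReal.ofReal (E z) *
          ENNReal.ofReal (fieldDensity (W' z) (κ' z) u) := by
          refine lintegral_lintegral_swap (Measurable.aemeasurable ?_)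
          exact (ENNReal.measurable_ofReal.comp (hcE.measurable.comp measurable_snd)).mul
            (ENNReal.measurable_ofReal.comp hcF.measurable)
      _ ≤ ∫⁻ z : ℝ, ENNReal.ofReal (E z) * ENNReal.ofReal
          (√(2 * π) ^ n * exp (-((∑ i, ∑ j, W' z i j) / 2 + ∑ i, κ' z i))) := by
          refine lintegral_mono fun z => ?_
          rw [lintegral_const_mul' _ _ ENNReal.ofReal_ne_top]
          gcongr
          exact ih (W' z) (κ' z) (fun i j => by simp only [W', Matrix.of_apply, hsymm i.succ]; ring)
            (fun i j => add_nonneg (hW _ _)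
              (mul_nonneg (mul_nonneg (hW _ _) (hW _ _)) (exp_pos _).le))
            (fun i => add_nonneg (hκ _)
              (mul_nonneg (mul_nonneg (hW _ _) (hκ _)) (exp_pos _).le))
      _ = ∫⁻ z : ℝ, ENNReal.ofReal (√(2 * π) ^ n * exp (-(W 0 0 / 2 +
            (∑ i : Fin n, ∑ j : Fin n, W i.succ j.succ) / 2 + ∑ i : Fin n, κ i.succ))) *
          ENNReal.ofReal (exp (z / 2 - exp z / 2 - B ^ 2 * exp (-z) / 2)) := by
          refine lintegral_congr fun z => ?_
          rw [← ENNReal.ofReal_mul (exp_pos _).le, ← ENNReal.ofReal_mul (by positivity),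
            mul_left_comm, mul_assoc, ← exp_add, ← exp_add]
          congr 3
          simp only [W', κ', Matrix.of_apply, Finset.sum_add_distrib, ← Finset.sum_mul,
            ← Finset.mul_sum, B]
          ring
      _ = _ := by
          rw [lintegral_const_mul' _ _ ENNReal.ofReal_ne_top, lintegral_inverseGaussian hB,
            ← ENNReal.ofReal_mul (by positivity), mul_mul_mul_comm, ← exp_add, ← pow_succ]
          congr 3
          rw [Fin.sum_univ_succ, Fin.sum_univ_succ, Fin.sum_univ_succ]
          simp only [Fin.sum_univ_succ (n := n), Finset.sum_add_distrib, hsymm (Fin.succ _) 0, B]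
          ring

lemma lintegral_fieldDensity_le {ι : Type*} [Fintype ι] [DecidableEq ι] (W : Matrix ι ι ℝ)
    (κ : ι → ℝ) (hsymm : ∀ i j, W i j = W j i) (hW : ∀ i j, 0 ≤ W i j) (hκ : ∀ i, 0 ≤ κ i) :
    ∫⁻ u, ENNReal.ofReal (fieldDensity W κ u) ≤ ENNReal.ofReal
      (√(2 * π) ^ Fintype.card ι * exp (-((∑ i, ∑ j, W i j) / 2 + ∑ i, κ i))) := by
  set e := Fintype.equivFin ι
  have hmp := volume_measurePreserving_piCongrLeft (fun _ : Fin (Fintype.card ι) => ℝ) e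
  have h := lintegral_fieldDensity_le_fin (W.submatrix e.symm e.symm) (κ ∘ e.symm)
    (fun i j => hsymm _ _) (fun i j => hW _ _) (fun i => hκ _)
  rw [← hmp.lintegral_comp_emb (MeasurableEquiv.measurableEmbedding _)] at h
  have key : ∀ u, fieldDensity (W.submatrix e.symm e.symm) (κ ∘ e.symm)
      (MeasurableEquiv.piCongrLeft (fun _ => ℝ) e u) = fieldDensity W κ u := fun u => by
    have hX : ∀ i, schrodDiag (W.submatrix e.symm e.symm) (κ ∘ e.symm)
        (MeasurableEquiv.piCongrLeft (fun _ => ℝ) e u) (e i) = schrodDiag W κ u i := fun i => by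
      unfold schrodDiag
      rw [← e.sum_comp]
      simp [MeasurableEquiv.coe_piCongrLeft, Equiv.piCongrLeft_apply]
    unfold fieldDensity
    congr 2
    · rw [← Matrix.det_submatrix_equiv_self e]
      congr 1
      ext i j
      simp [Matrix.diagonal_apply, hX]
    · rw [← e.sum_comp, ← e.sum_comp (fun i => _ * _)]
      simp only [hX]
      simp [MeasurableEquiv.coe_piCongrLeft, Equiv.piCongrLeft_apply]
  have hsum : ∑ i, ∑ j, (W.submatrix e.symm e.symm) i j = ∑ i, ∑ j, W i j := by
    rw [← e.sum_comp]
    exact Finset.sum_congr rfl fun i _ => by rw [← e.sum_comp]; simp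
  have hsum' : ∑ i, (κ ∘ e.symm) i = ∑ i, κ i := e.symm.sum_comp κ
  rw [hsum, hsum'] at h
  simpa only [key] using h

/-- Conductance matrix of a weighted graph. -/
def condMat (G : SimpleGraph V) [DecidableRel G.Adj] (w : Sym2 V → ℝ) (i j : V) : ℝ :=
  if G.Adj i j then w s(i, j) else 0

lemma condMat_comm (G : SimpleGraph V) [DecidableRel G.Adj] (w : Sym2 V → ℝ) (i j : V) :
    condMat G w i j = condMat G w j i := by
  simp [condMat, G.adj_comm i j, Sym2.eq_swap (a := i)]

lemma vw_eq_sum_condMat (G : SimpleGraph V) [DecidableRel G.Adj] (w : Sym2 V → ℝ) (i : V) :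
    vw G w i = ∑ j, condMat G w i j := by
  simp [vw, condMat, SimpleGraph.neighborFinset_eq_filter, Finset.sum_filter]

/-- Matrix `I - P` for the map `f`, with the vertex `v0` removed. -/
def mapLaplacian (v0 : V) (f : {v // v ≠ v0} → V) : Matrix {v // v ≠ v0} {v // v ≠ v0} ℝ :=
  Matrix.of fun i j => (if i = j then 1 else 0) - if f i = j then 1 else 0

lemma det_mapLaplacian_nonneg (v0 : V) (f : {v // v ≠ v0} → V) :
    0 ≤ (mapLaplacian v0 f).det := by
  let M : ℝ → Matrix {v // v ≠ v0} {v // v ≠ v0} ℝ := fun t =>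
    Matrix.of fun i j => (if i = j then 1 else 0) - t * if f i = j then 1 else 0
  have hcont : Continuous fun t => (M t).det := by
    refine Continuous.matrix_det (continuous_matrix fun i j => ?_)
    simp only [M, Matrix.of_apply]
    fun_prop
  have hM0 : (M 0).det = 1 := by
    have : M 0 = 1 := by
      ext i j
      simp [M, Matrix.one_apply]
    rw [this, Matrix.det_one]
  have hM1 : M 1 = mapLaplacian v0 f := by
    ext i j
    simp [M, mapLaplacian]
  have hne : ∀ t ∈ Set.Ico (0 : ℝ) 1, (M t).det ≠ 0 := by
    rintro t ⟨ht0, ht1⟩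
    refine det_ne_zero_of_sum_row_lt_diag fun k => ?_
    have hle : ∑ j, (if f k = (j : {v // v ≠ v0}) then (1 : ℝ) else 0) ≤ 1 := by
      by_cases hk : f k = v0
      · rw [Finset.sum_eq_zero]
        · norm_num
        · intro j _
          rw [if_neg]
          rw [hk]
          exact fun h => j.2 h.symm
      · rw [Finset.sum_eq_single ⟨f k, hk⟩]
        · simp
        · rintro j - hj
          rw [if_neg]
          exact fun h => hj (Subtype.ext h.symm)
        · simp
    rw [← Finset.add_sum_erase _ _ (Finset.mem_univ k)] at hle
    have h1 : ∑ j ∈ Finset.univ.erase k, ‖M t k j‖ =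
        t * ∑ j ∈ Finset.univ.erase k, (if f k = (j : {v // v ≠ v0}) then (1 : ℝ) else 0) := by
      rw [Finset.mul_sum]
      refine Finset.sum_congr rfl fun j hj => ?_
      have : k ≠ j := (Finset.ne_of_mem_erase hj).symm
      simp only [M, Matrix.of_apply, if_neg this, zero_sub, norm_neg, norm_mul]
      split_ifs <;> simp [abs_of_nonneg ht0]
    have h2 : ‖M t k k‖ = 1 - t * (if f k = k then (1 : ℝ) else 0) := by
      simp only [M, Matrix.of_apply, if_true, norm_eq_abs]
      rw [abs_of_nonneg]
      split_ifs <;> linarith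
    rw [h1, h2]
    nlinarith
  have hpos : ∀ t ∈ Set.Ico (0 : ℝ) 1, 0 ≤ (M t).det := by
    rintro t ⟨ht0, ht1⟩
    by_contra! hlt
    obtain ⟨s, hs, hs0⟩ := intermediate_value_Icc' ht0 hcont.continuousOn
      (⟨hlt.le, by rw [hM0]; norm_num⟩ : (0 : ℝ) ∈ Set.Icc (M t).det (M 0).det)
    exact hne s ⟨hs.1, hs.2.trans_lt ht1⟩ hs0
  rw [← hM1]
  have hclos : (1 : ℝ) ∈ closure (Set.Ico (0 : ℝ) 1) := by
    rw [closure_Ico (by norm_num)]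
    simp
  exact closure_minimal (t := {t | 0 ≤ (M t).det}) hpos
    (isClosed_le continuous_const hcont) hclos

lemma det_mapLaplacian_eq_one (v0 : V) (f : {v // v ≠ v0} → V) (d : V → ℕ)
    (hf : ∀ i, d (f i) < d i) : (mapLaplacian v0 f).det = 1 := by
  have hb : (mapLaplacian v0 f).BlockTriangular fun i => OrderDual.toDual (d i) := by
    intro i j hij
    have hij' : d i < d j := hij
    have h1 : i ≠ j := by
      rintro rfl
      exact lt_irrefl _ hij'
    have h2 : f i ≠ j := fun h => by
      have := hf i
      rw [h] at this
      omega
    simp [mapLaplacian, h1, h2]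
  rw [hb.det]
  refine Finset.prod_eq_one fun a _ => ?_
  convert (Matrix.det_one : (1 : Matrix {i : {v // v ≠ v0} // OrderDual.toDual (d i) = a} _ ℝ).det = 1)
  ext i j
  have h2 : f i.1 ≠ j.1 := fun h => by
    have h3 := hf i.1
    have h4 : d i.1 = d j.1 := by
      have := i.2.trans j.2.symm
      exact OrderDual.toDual.injective this
    rw [h] at h3
    omega
  simp [Matrix.toSquareBlock, Matrix.toSquareBlockProp, mapLaplacian, h2, Matrix.one_apply, Subtype.ext_iff]

lemma det_reduced_laplacian (G : SimpleGraph V) [DecidableRel G.Adj] (v0 : V)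
    (w : Sym2 V → ℝ) :
    (Matrix.of fun i j : {v // v ≠ v0} =>
        (if i = j then vw G w i else 0) - condMat G w i j).det =
      ∑ f : {v // v ≠ v0} → V, (∏ i : {v // v ≠ v0}, condMat G w i (f i)) *
        (mapLaplacian v0 f).det := by
  have h : (Matrix.of fun i j : {v // v ≠ v0} =>
      (if i = j then vw G w i else 0) - condMat G w i j) = fun i : {v // v ≠ v0} => ∑ k : V,
        condMat G w i k • fun j : {v // v ≠ v0} =>
          ((if i = j then 1 else 0) - if k = j then 1 else 0 : ℝ) := by
    ext i j
    simp only [Matrix.of_apply, Finset.sum_apply, Pi.smul_apply, smul_eq_mul, mul_sub,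
      Finset.sum_sub_distrib, vw_eq_sum_condMat]
    simp
  rw [h]
  change Matrix.detRowAlternating.toMultilinearMap _ = _
  rw [MultilinearMap.map_sum]
  refine Finset.sum_congr rfl fun f _ => ?_
  rw [MultilinearMap.map_smul_univ]
  rfl

lemma exists_map_of_mem_spanningTrees (G : SimpleGraph V) [DecidableRel G.Adj] (v0 : V)
    {F : Finset (Sym2 V)} (hF : F ∈ spanningTrees G) :
    ∃ f : {v // v ≠ v0} → V, (∀ i : {v // v ≠ v0}, G.Adj i (f i)) ∧ (mapLaplacian v0 f).det = 1 ∧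
      Function.Injective (fun i : {v // v ≠ v0} => s((i : V), f i)) ∧
      Finset.univ.image (fun i : {v // v ≠ v0} => s((i : V), f i)) = F := by
  simp only [spanningTrees, Finset.mem_filter, Finset.mem_powerset] at hF
  obtain ⟨hFG, hT⟩ := hF
  set H := SimpleGraph.fromEdgeSet (F : Set (Sym2 V)) with hH
  have hstep : ∀ i : {v // v ≠ v0}, ∃ u, H.Adj i u ∧ H.dist u v0 < H.dist i v0 := by
    intro i
    obtain ⟨i, hi⟩ := i
    obtain ⟨p, hp⟩ := hT.1.exists_walk_length_eq_dist i v0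
    cases p with
    | nil => exact absurd rfl hi
    | cons h p =>
      refine ⟨_, h, ?_⟩
      rw [← hp, SimpleGraph.Walk.length_cons]
      exact Nat.lt_succ_of_le (SimpleGraph.dist_le p)
  choose f hadj hdist using hstep
  have hmemF : ∀ i : {v // v ≠ v0}, s((i : V), f i) ∈ F := fun i => by
    have := hadj i
    rw [hH, SimpleGraph.fromEdgeSet_adj] at this
    exact this.1
  have hinj : Function.Injective (fun i : {v // v ≠ v0} => s((i : V), f i)) := by
    intro i j hij
    rcases Sym2.eq_iff.1 hij with ⟨h, -⟩ | ⟨h1, h2⟩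
    · exact Subtype.ext h
    · have h3 := hdist i
      have h4 := hdist j
      rw [h2] at h3
      rw [← h1] at h4
      omega
  refine ⟨f, fun i => ?_, det_mapLaplacian_eq_one v0 f (fun v => H.dist v v0) hdist, hinj, ?_⟩
  · have := hFG (hmemF i)
    rwa [SimpleGraph.mem_edgeFinset] at this
  · refine Finset.eq_of_subset_of_card_le ?_ ?_
    · intro e he
      obtain ⟨i, -, rfl⟩ := Finset.mem_image.1 he
      exact hmemF i
    · rw [Finset.card_image_of_injective _ hinj, Finset.card_univ]
      have h1 := hT.card_edgeFinset
      have h2 : H.edgeFinset = F := by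
        ext e
        rw [SimpleGraph.mem_edgeFinset, hH, SimpleGraph.edgeSet_fromEdgeSet]
        simp only [Set.mem_sdiff, Finset.mem_coe]
        refine ⟨fun h => h.1, fun h => ⟨h, fun hd => ?_⟩⟩
        have := hFG h
        rw [SimpleGraph.mem_edgeFinset] at this
        exact G.not_isDiag_of_mem_edgeSet this hd
      rw [h2] at h1
      have h3 : Fintype.card {v // v ≠ v0} = Fintype.card V - 1 := by
        rw [Fintype.card_subtype_compl, Fintype.card_subtype_eq]
      omega

/-- One half of the matrix-tree theorem. -/
lemma tau_le_det (G : SimpleGraph V) [DecidableRel G.Adj] (v0 : V) (w : Sym2 V → ℝ)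
    (hw : ∀ e ∈ G.edgeFinset, 0 ≤ w e) :
    tau G w ≤ (Matrix.of fun i j : {v // v ≠ v0} =>
        (if i = j then vw G w i else 0) - condMat G w i j).det := by
  rw [det_reduced_laplacian]
  have hch : ∀ F : Finset (Sym2 V), ∃ f : {v // v ≠ v0} → V, F ∈ spanningTrees G →
      (∀ i : {v // v ≠ v0}, G.Adj i (f i)) ∧ (mapLaplacian v0 f).det = 1 ∧
      Function.Injective (fun i : {v // v ≠ v0} => s((i : V), f i)) ∧
      Finset.univ.image (fun i : {v // v ≠ v0} => s((i : V), f i)) = F := by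
    intro F
    by_cases hF : F ∈ spanningTrees G
    · obtain ⟨f, hf⟩ := exists_map_of_mem_spanningTrees G v0 hF
      exact ⟨f, fun _ => hf⟩
    · exact ⟨fun i => i, fun h => absurd h hF⟩
  choose f hf using hch
  have hinj : Set.InjOn f (spanningTrees G) := by
    intro F hF F' hF' h
    rw [← (hf F hF).2.2.2, ← (hf F' hF').2.2.2, h]
  have hnn : ∀ i j, 0 ≤ condMat G w i j := by
    intro i j
    unfold condMat
    split_ifs with h
    · exact hw _ (SimpleGraph.mem_edgeFinset.2 h)
    · exact le_rfl
  calc tau G w = ∑ F ∈ spanningTrees G, (∏ i : {v // v ≠ v0}, condMat G w i (f F i)) *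
        (mapLaplacian v0 (f F)).det := by
        refine Finset.sum_congr rfl fun F hF => ?_
        obtain ⟨h1, h2, h3, h4⟩ := hf F hF
        rw [h2, mul_one]
        conv_lhs => rw [← h4]
        rw [Finset.prod_image fun _ _ _ _ h => h3 h]
        exact Finset.prod_congr rfl fun i _ => by rw [condMat, if_pos (h1 i)]
    _ = ∑ g ∈ (spanningTrees G).image f, (∏ i : {v // v ≠ v0}, condMat G w i (g i)) *
        (mapLaplacian v0 g).det := by rw [Finset.sum_image hinj]
    _ ≤ _ := Finset.sum_le_sum_of_subset_of_nonneg (Finset.subset_univ _) fun g _ _ =>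
        mul_nonneg (Finset.prod_nonneg fun i _ => hnn _ _) (det_mapLaplacian_nonneg v0 g)

lemma vw_eq_sum_edgeFinset (G : SimpleGraph V) [DecidableRel G.Adj] (f : Sym2 V → ℝ) (v : V) :
    vw G f v = ∑ e ∈ G.edgeFinset, if v ∈ e then f e else 0 := by
  rw [vw, ← Finset.sum_filter]
  refine Finset.sum_nbij (fun j => s(v, j)) ?_ ?_ ?_ fun _ _ => rfl
  · intro j hj
    simpa using hj
  · intro j _ k _ h
    exact Sym2.congr_right.1 h
  · intro e he
    simp only [Finset.coe_filter, SimpleGraph.mem_edgeFinset, Set.mem_ofPred_eq] at he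
    obtain ⟨he, j, rfl⟩ := he
    exact ⟨j, by simpa using he, rfl⟩

/-- Weighted handshake lemma. -/
lemma sum_edgeFinset_mul_ssum (G : SimpleGraph V) [DecidableRel G.Adj] (f : Sym2 V → ℝ)
    (Y : V → ℝ) : ∑ e ∈ G.edgeFinset, f e * ssum Y e = ∑ v, vw G f v * Y v := by
  simp_rw [vw_eq_sum_edgeFinset, Finset.sum_mul]
  rw [Finset.sum_comm]
  refine Finset.sum_congr rfl fun e he => ?_
  induction e with
  | _ i j =>
    have hij : i ≠ j := by
      rw [SimpleGraph.mem_edgeFinset] at he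
      exact G.ne_of_adj he
    have h : ∀ v, (if v ∈ s(i, j) then f s(i, j) else 0) * Y v =
        (if v = i then f s(i, j) * Y v else 0) + if v = j then f s(i, j) * Y v else 0 := by
      intro v
      by_cases h1 : v = i
      · subst h1
        simp [hij]
      · by_cases h2 : v = j <;> simp [h1, h2, hij.symm]
    simp_rw [h, Finset.sum_add_distrib]
    simp [ssum, mul_add]

lemma sum_vw (G : SimpleGraph V) [DecidableRel G.Adj] (f : Sym2 V → ℝ) :
    ∑ v, vw G f v = 2 * ∑ e ∈ G.edgeFinset, f e := by
  have h := sum_edgeFinset_mul_ssum G f fun _ => 1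
  have h1 : ∀ e : Sym2 V, ssum (fun _ => 1) e = 2 := by
    intro e
    induction e with
    | _ i j => norm_num [ssum]
  simp only [h1, mul_one] at h
  rw [← h, ← Finset.sum_mul, mul_comm]

lemma sum_eq_add_sum_subtype_ne {M : Type*} [AddCommMonoid M] (v0 : V) (f : V → M) :
    ∑ v, f v = f v0 + ∑ i : {v // v ≠ v0}, f i := by
  rw [← Finset.add_sum_erase _ _ (Finset.mem_univ v0)]
  congr 1
  exact (Finset.sum_subtype _ (by simp) _)

lemma prod_eq_mul_prod_subtype_ne {M : Type*} [CommMonoid M] (v0 : V) (f : V → M) :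
    ∏ v, f v = f v0 * ∏ i : {v // v ≠ v0}, f i := by
  rw [← Finset.mul_prod_erase _ _ (Finset.mem_univ v0)]
  congr 1
  exact (Finset.prod_subtype _ (by simp) _)

lemma prod_edgeFinset_eq_mul {M : Type*} [CommMonoid M] (G : SimpleGraph V) [DecidableRel G.Adj]
    {e0 : Sym2 V} (he0 : e0 ∈ G.edgeFinset) (f : Sym2 V → M) :
    ∏ e ∈ G.edgeFinset, f e = f e0 * ∏ i : Epin G e0, f i := by
  rw [← Finset.mul_prod_erase _ _ he0]
  congr 1
  exact (Finset.prod_subtype _ (by simp [and_comm]) _)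

lemma sum_edgeFinset_eq_add {M : Type*} [AddCommMonoid M] (G : SimpleGraph V)
    [DecidableRel G.Adj] {e0 : Sym2 V} (he0 : e0 ∈ G.edgeFinset) (f : Sym2 V → M) :
    ∑ e ∈ G.edgeFinset, f e = f e0 + ∑ i : Epin G e0, f i := by
  rw [← Finset.add_sum_erase _ _ he0]
  congr 1
  exact (Finset.sum_subtype _ (by simp [and_comm]) _)

/-- Weights with prescribed logarithms on the edges. -/
def expWeight (G : SimpleGraph V) [DecidableRel G.Adj] (θ : Sym2 V → ℝ) (e : Sym2 V) : ℝ :=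
  if e ∈ G.edgeFinset then exp (θ e) else 0

/-- Logarithmic edge coordinates assembled from the one of `e0` and the others. -/
def joinLog (G : SimpleGraph V) [DecidableRel G.Adj] (e0 : Sym2 V) (l : ℝ)
    (s : Epin G e0 → ℝ) (e : Sym2 V) : ℝ :=
  if e = e0 then l else if h : e ∈ G.edgeFinset ∧ e ≠ e0 then s ⟨e, h⟩ else 0

lemma joinLog_self (G : SimpleGraph V) [DecidableRel G.Adj] (e0 : Sym2 V) (l : ℝ)
    (s : Epin G e0 → ℝ) : joinLog G e0 l s e0 = l := if_pos rfl

lemma joinLog_coe (G : SimpleGraph V) [DecidableRel G.Adj] (e0 : Sym2 V) (l : ℝ)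
    (s : Epin G e0 → ℝ) (i : Epin G e0) : joinLog G e0 l s i = s i := by
  rw [joinLog, if_neg i.2.2, dif_pos i.2]

lemma pinExt_exp (G : SimpleGraph V) [DecidableRel G.Adj] {e0 : Sym2 V}
    (he0 : e0 ∈ G.edgeFinset) (t : Epin G e0 → ℝ) :
    pinExt G e0 (fun i => exp (t i)) = expWeight G (joinLog G e0 0 t) := by
  ext e
  unfold pinExt expWeight joinLog
  by_cases h : e = e0
  · subst h
    simp [he0]
  · by_cases h2 : e ∈ G.edgeFinset <;> simp [h, h2]

lemma expWeight_nonneg (G : SimpleGraph V) [DecidableRel G.Adj] (θ : Sym2 V → ℝ) (e : Sym2 V) :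
    0 ≤ expWeight G θ e := by
  unfold expWeight
  split_ifs <;> positivity

lemma expWeight_pos (G : SimpleGraph V) [DecidableRel G.Adj] (θ : Sym2 V → ℝ) {e : Sym2 V}
    (he : e ∈ G.edgeFinset) : 0 < expWeight G θ e := by
  rw [expWeight, if_pos he]
  positivity

lemma condMat_expWeight (G : SimpleGraph V) [DecidableRel G.Adj] (θ : Sym2 V → ℝ) (i j : V) :
    condMat G (expWeight G θ) i j = if G.Adj i j then exp (θ s(i, j)) else 0 := by
  unfold condMat expWeight
  split_ifs with h h2
  · rfl
  · exact absurd (SimpleGraph.mem_edgeFinset.2 h) h2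
  · rfl

lemma condMat_nonneg (G : SimpleGraph V) [DecidableRel G.Adj] (θ : Sym2 V → ℝ) (i j : V) :
    0 ≤ condMat G (expWeight G θ) i j := by
  rw [condMat_expWeight]
  split_ifs <;> positivity

lemma vw_pos (G : SimpleGraph V) [DecidableRel G.Adj] (hG : ∀ v, ∃ u, G.Adj v u)
    {w : Sym2 V → ℝ} (hw : ∀ e ∈ G.edgeFinset, 0 < w e) (v : V) : 0 < vw G w v := by
  obtain ⟨u, hu⟩ := hG v
  refine Finset.sum_pos (fun j hj => hw _ ?_) ⟨u, by simpa using hu⟩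
  simpa using hj

lemma exists_adj_of_connected {G : SimpleGraph V} [DecidableRel G.Adj] (hG : G.Connected)
    {e0 : Sym2 V} (he0 : e0 ∈ G.edgeFinset) (v : V) : ∃ u, G.Adj v u := by
  induction e0 with
  | _ i j =>
    have hij : G.Adj i j := by simpa using he0
    have : Nontrivial V := ⟨i, j, G.ne_of_adj hij⟩
    exact hG.preconnected.exists_adj_of_nontrivial v

/-- Conductances between the vertices other than the root. -/
def innerCond (G : SimpleGraph V) [DecidableRel G.Adj] (v0 : V) (w : Sym2 V → ℝ) :
    Matrix {v // v ≠ v0} {v // v ≠ v0} ℝ :=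
  Matrix.of fun i j => condMat G w i j

/-- Conductances to the root. -/
def rootCond (G : SimpleGraph V) [DecidableRel G.Adj] (v0 : V) (w : Sym2 V → ℝ)
    (i : {v // v ≠ v0}) : ℝ :=
  condMat G w i v0

/-- Extension by zero at the root. -/
def extendZero (v0 : V) (y : {v // v ≠ v0} → ℝ) (v : V) : ℝ :=
  if h : v ≠ v0 then y ⟨v, h⟩ else 0

lemma extendZero_root (v0 : V) (y : {v // v ≠ v0} → ℝ) : extendZero v0 y v0 = 0 := by
  simp [extendZero]

lemma extendZero_coe (v0 : V) (y : {v // v ≠ v0} → ℝ) (i : {v // v ≠ v0}) :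
    extendZero v0 y i = y i := by
  simp [extendZero, i.2]

section Gauge

variable (G : SimpleGraph V) [DecidableRel G.Adj] (v0 : V) {θ Θ : Sym2 V → ℝ}
  {y : {v // v ≠ v0} → ℝ} {l : ℝ}

lemma condMat_gauge (h : ∀ e ∈ G.edgeFinset, θ e = Θ e + ssum (extendZero v0 y) e - l) (i j : V) :
    condMat G (expWeight G θ) i j =
      condMat G (expWeight G Θ) i j * exp (extendZero v0 y i + extendZero v0 y j - l) := by
  rw [condMat_expWeight, condMat_expWeight]
  split_ifs with hij
  · rw [h _ (SimpleGraph.mem_edgeFinset.2 hij), ← exp_add]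
    congr 1
    simp [ssum]
    ring
  · simp

lemma vw_root_gauge (h : ∀ e ∈ G.edgeFinset, θ e = Θ e + ssum (extendZero v0 y) e - l) :
    vw G (expWeight G θ) v0 * exp l =
      ∑ i, rootCond G v0 (expWeight G Θ) i * exp (y i) := by
  rw [vw_eq_sum_condMat, sum_eq_add_sum_subtype_ne v0, add_mul, Finset.sum_mul]
  have h0 : condMat G (expWeight G θ) v0 v0 = 0 := by simp [condMat]
  rw [h0, zero_mul, zero_add]
  refine Finset.sum_congr rfl fun i _ => ?_
  rw [condMat_gauge G v0 h, extendZero_root, extendZero_coe, mul_assoc, ← exp_add, rootCond,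
    condMat_comm]
  ring_nf

lemma vw_gauge (h : ∀ e ∈ G.edgeFinset, θ e = Θ e + ssum (extendZero v0 y) e - l)
    (i : {v // v ≠ v0}) :
    vw G (expWeight G θ) i = schrodDiag (innerCond G v0 (expWeight G Θ))
      (rootCond G v0 (expWeight G Θ)) y i * exp (2 * y i - l) := by
  rw [vw_eq_sum_condMat, sum_eq_add_sum_subtype_ne v0, schrodDiag, mul_assoc, ← exp_add, add_mul,
    Finset.sum_mul]
  congr 1
  · rw [condMat_gauge G v0 h, extendZero_root, extendZero_coe, rootCond]
    ring_nf
  · refine Finset.sum_congr rfl fun j _ => ?_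
    rw [condMat_gauge G v0 h, extendZero_coe, extendZero_coe, innerCond, Matrix.of_apply,
      mul_assoc, ← exp_add]
    ring_nf

lemma tau_le_gauge (h : ∀ e ∈ G.edgeFinset, θ e = Θ e + ssum (extendZero v0 y) e - l) :
    tau G (expWeight G θ) ≤ exp (∑ i, (y i - l / 2)) ^ 2 *
      (Matrix.diagonal (schrodDiag (innerCond G v0 (expWeight G Θ))
        (rootCond G v0 (expWeight G Θ)) y) - innerCond G v0 (expWeight G Θ)).det := by
  refine (tau_le_det G v0 _ fun e _ => expWeight_nonneg G θ e).trans_eq ?_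
  rw [sq, mul_assoc, exp_sum, ← Matrix.det_mul_row, ← Matrix.det_mul_column]
  congr 1
  ext i j
  simp only [Matrix.of_apply, Matrix.sub_apply, Matrix.diagonal_apply, innerCond]
  rw [condMat_gauge G v0 h, extendZero_coe, extendZero_coe]
  have h2 : exp (y i + y j - l) = exp (y i - l / 2) * exp (y j - l / 2) := by
    rw [← exp_add]
    ring_nf
  rw [h2]
  split_ifs with hij
  · subst hij
    have h3 : exp (2 * y i - l) = exp (y i - l / 2) * exp (y i - l / 2) := by
      rw [← exp_add]
      ring_nf
    rw [vw_gauge G v0 h, h3, innerCond]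
    ring
  · ring

/-- Integrand of the unnormalized mixing measure, with the vertex weights represented by Gamma
integrals. -/
def liftedDensity (a θ : Sym2 V → ℝ) (l : ℝ) (u : {v // v ≠ v0} → ℝ) : ℝ :=
  exp (∑ e ∈ G.edgeFinset, a e * θ e - ∑ i : {v // v ≠ v0}, (vw G a i + 1) * u i -
    (∑ i : {v // v ≠ v0}, vw G (expWeight G θ) i * exp (-(2 * u i))) / 2 +
    vw G a v0 / 2 * l - vw G (expWeight G θ) v0 * exp l / 2) * √(tau G (expWeight G θ))

lemma liftedDensity_le (a : Sym2 V → ℝ)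
    (h : ∀ e ∈ G.edgeFinset, θ e = Θ e + ssum (extendZero v0 y) e - l) :
    liftedDensity G v0 a θ l (fun i => y i - l / 2) ≤ exp (∑ e ∈ G.edgeFinset, a e * Θ e) *
      fieldDensity (innerCond G v0 (expWeight G Θ)) (rootCond G v0 (expWeight G Θ)) y := by
  have ht := Real.sqrt_le_sqrt (tau_le_gauge G v0 h)
  rw [Real.sqrt_mul (sq_nonneg _), Real.sqrt_sq (exp_pos _).le] at ht
  refine (mul_le_mul_of_nonneg_left ht (exp_pos _).le).trans_eq ?_
  rw [fieldDensity, ← mul_assoc, ← exp_add, mul_comm (√_), ← mul_assoc, ← exp_add]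
  congr 2
  have h1 : ∑ e ∈ G.edgeFinset, a e * θ e = ∑ e ∈ G.edgeFinset, a e * Θ e +
      ∑ i : {v // v ≠ v0}, vw G a i * y i -
        (vw G a v0 + ∑ i : {v // v ≠ v0}, vw G a i) * (l / 2) := by
    have h2 := sum_edgeFinset_mul_ssum G a (extendZero v0 y)
    have h3 := sum_vw G a
    rw [sum_eq_add_sum_subtype_ne v0] at h2 h3
    simp only [extendZero_coe, extendZero_root, mul_zero, zero_add] at h2
    rw [h3, ← h2, mul_div_assoc', mul_comm 2, mul_assoc, mul_div_assoc, mul_div_cancel_left₀ _ two_ne_zero,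
      Finset.sum_mul, ← Finset.sum_add_distrib, ← Finset.sum_sub_distrib]
    exact Finset.sum_congr rfl fun e he => by rw [h e he]; ring
  have h4 : ∑ i : {v // v ≠ v0}, vw G (expWeight G θ) i * exp (-(2 * (y i - l / 2))) =
      ∑ i, schrodDiag (innerCond G v0 (expWeight G Θ)) (rootCond G v0 (expWeight G Θ)) y i := by
    refine Finset.sum_congr rfl fun i _ => ?_
    rw [vw_gauge G v0 h, mul_assoc, ← exp_add]
    ring_nf
    simp
  rw [h1, h4, vw_root_gauge G v0 h]
  have h5 : ∑ i : {v // v ≠ v0}, (vw G a i + 1) * (y i - l / 2) =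
      ∑ i : {v // v ≠ v0}, vw G a i * y i - (∑ i : {v // v ≠ v0}, vw G a i) * (l / 2) +
        ∑ i, (y i - l / 2) := by
    rw [Finset.sum_mul, ← Finset.sum_sub_distrib, ← Finset.sum_add_distrib]
    exact Finset.sum_congr rfl fun i _ => by ring
  rw [h5]
  ring

end Gauge

lemma lintegral_swap_left {α β γ : Type*} [MeasurableSpace α] [MeasurableSpace β]
    [MeasurableSpace γ] {μ : Measure α} {ν : Measure β} {ρ : Measure γ} [SFinite μ] [SFinite ν]
    [SFinite ρ] {f : α → β → γ → ℝ≥0∞} (hf : Measurable fun p : α × β × γ => f p.1 p.2.1 p.2.2) :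
    ∫⁻ x, ∫⁻ y, ∫⁻ z, f x y z ∂ρ ∂ν ∂μ = ∫⁻ y, ∫⁻ x, ∫⁻ z, f x y z ∂ρ ∂μ ∂ν := by
  refine lintegral_lintegral_swap (Measurable.aemeasurable ?_)
  exact Measurable.lintegral_prod_right' (f := fun p : (α × β) × γ => f p.1.1 p.1.2 p.2)
    (hf.comp (by fun_prop : Measurable fun p : (α × β) × γ => (p.1.1, p.1.2, p.2)))

lemma lintegral_rotate {α β γ : Type*} [MeasurableSpace α] [MeasurableSpace β]
    [MeasurableSpace γ] {μ : Measure α} {ν : Measure β} {ρ : Measure γ} [SFinite μ] [SFinite ν]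
    [SFinite ρ] {f : α → β → γ → ℝ≥0∞} (hf : Measurable fun p : α × β × γ => f p.1 p.2.1 p.2.2) :
    ∫⁻ x, ∫⁻ y, ∫⁻ z, f x y z ∂ρ ∂ν ∂μ = ∫⁻ y, ∫⁻ z, ∫⁻ x, f x y z ∂μ ∂ρ ∂ν := by
  rw [lintegral_swap_left hf]
  refine lintegral_congr fun y => lintegral_lintegral_swap (Measurable.aemeasurable ?_)
  exact hf.comp (by fun_prop : Measurable fun p : α × γ => (p.1, y, p.2))

lemma lintegral_gauge {ι κ : Type*} [Fintype ι] [Fintype κ]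
    (F : (ι → ℝ) → ℝ → (κ → ℝ) → ℝ≥0∞)
    (hF : Measurable fun p : (ι → ℝ) × ℝ × (κ → ℝ) => F p.1 p.2.1 p.2.2)
    (d : (κ → ℝ) → ℝ) (hd : Measurable d) (c : ℝ → (κ → ℝ) → ι → ℝ)
    (hc : Measurable fun p : ℝ × (κ → ℝ) => c p.1 p.2) :
    ∫⁻ t, ∫⁻ l, ∫⁻ u, F t l u =
      ∫⁻ l, ∫⁻ s, ∫⁻ y : κ → ℝ, F (s + c (l + d y) y) (l + d y) fun i => y i - (l + d y) / 2 := by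
  calc ∫⁻ t, ∫⁻ l, ∫⁻ u, F t l u
      = ∫⁻ t, ∫⁻ l, ∫⁻ y : κ → ℝ, F t l fun i => y i - l / 2 :=
        lintegral_congr fun t => lintegral_congr fun l =>
          (lintegral_sub_right_eq_self (F t l) fun _ => l / 2).symm
    _ = ∫⁻ l, ∫⁻ y : κ → ℝ, ∫⁻ t, F t l fun i => y i - l / 2 := by
        refine lintegral_rotate (f := fun t l (y : κ → ℝ) => F t l fun i => y i - l / 2) ?_
        exact hF.comp (by fun_prop : Measurable fun p : (ι → ℝ) × ℝ × (κ → ℝ) =>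
          (p.1, p.2.1, fun i => p.2.2 i - p.2.1 / 2))
    _ = ∫⁻ y : κ → ℝ, ∫⁻ l, ∫⁻ t, F t l fun i => y i - l / 2 := by
        refine lintegral_swap_left (f := fun l (y : κ → ℝ) t => F t l fun i => y i - l / 2) ?_
        exact hF.comp (by fun_prop : Measurable fun p : ℝ × (κ → ℝ) × (ι → ℝ) =>
          (p.2.2, p.1, fun i => p.2.1 i - p.1 / 2))
    _ = ∫⁻ y : κ → ℝ, ∫⁻ l, ∫⁻ s, F (s + c (l + d y) y) (l + d y) fun i => y i - (l + d y) / 2 := by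
        refine lintegral_congr fun y => ?_
        rw [← lintegral_add_right_eq_self _ (d y)]
        refine lintegral_congr fun l => ?_
        exact (lintegral_add_right_eq_self _ _).symm
    _ = ∫⁻ l, ∫⁻ s, ∫⁻ y : κ → ℝ, F (s + c (l + d y) y) (l + d y) fun i => y i - (l + d y) / 2 := by
        refine lintegral_rotate (f := fun y l s =>
          F (s + c (l + d y) y) (l + d y) fun i => y i - (l + d y) / 2) ?_
        have h1 : Measurable fun p : (κ → ℝ) × ℝ × (ι → ℝ) => c (p.2.1 + d p.1) p.1 :=
          hc.comp (by fun_prop : Measurable fun p : (κ → ℝ) × ℝ × (ι → ℝ) => (p.2.1 + d p.1, p.1))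
        exact hF.comp (by fun_prop : Measurable fun p : (κ → ℝ) × ℝ × (ι → ℝ) =>
          (p.2.2 + c (p.2.1 + d p.1) p.1, p.2.1 + d p.1,
            fun i => p.1 i - (p.2.1 + d p.1) / 2))

section Continuity

variable {X : Type*} [TopologicalSpace X] (G : SimpleGraph V) [DecidableRel G.Adj]

lemma continuous_joinLog (e0 : Sym2 V) {l : X → ℝ} {s : X → Epin G e0 → ℝ} (hl : Continuous l)
    (hs : Continuous s) : Continuous fun x => joinLog G e0 (l x) (s x) := by
  refine continuous_pi fun e => ?_
  unfold joinLog
  split_ifs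
  · exact hl
  · exact (continuous_apply _).comp hs
  · exact continuous_const

lemma continuous_expWeight {θ : X → Sym2 V → ℝ} (hθ : Continuous θ) :
    Continuous fun x => expWeight G (θ x) := by
  refine continuous_pi fun e => ?_
  unfold expWeight
  split_ifs
  · fun_prop
  · fun_prop

lemma continuous_vw {w : X → Sym2 V → ℝ} (hw : Continuous w) (v : V) :
    Continuous fun x => vw G (w x) v := by
  unfold vw
  fun_prop

lemma continuous_tau {w : X → Sym2 V → ℝ} (hw : Continuous w) :
    Continuous fun x => tau G (w x) := by
  unfold tau
  fun_prop

lemma continuous_extendZero (v0 : V) {y : X → {v // v ≠ v0} → ℝ} (hy : Continuous y) :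
    Continuous fun x => extendZero v0 (y x) := by
  refine continuous_pi fun v => ?_
  unfold extendZero
  split_ifs
  · fun_prop
  · fun_prop

lemma continuous_ssum {f : X → V → ℝ} (hf : Continuous f) (e : Sym2 V) :
    Continuous fun x => ssum (f x) e := by
  induction e with
  | _ i j =>
    simp only [ssum, Sym2.lift_mk]
    fun_prop

lemma continuous_liftedDensity (v0 : V) (a : Sym2 V → ℝ) {θ : X → Sym2 V → ℝ} {l : X → ℝ}
    {u : X → {v // v ≠ v0} → ℝ} (hθ : Continuous θ) (hl : Continuous l) (hu : Continuous u) :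
    Continuous fun x => liftedDensity G v0 a (θ x) (l x) (u x) := by
  have h1 := continuous_expWeight G hθ
  have h2 := fun v => continuous_vw G h1 v
  have h3 := continuous_tau G h1
  have h4 : ∀ i, Continuous fun x => u x i := fun i => (continuous_apply i).comp hu
  have h5 : ∀ e, Continuous fun x => θ x e := fun i => (continuous_apply i).comp hθ
  unfold liftedDensity
  fun_prop

end Continuity

section Mass

variable (G : SimpleGraph V) [DecidableRel G.Adj] (v0 : V) {e0 : Sym2 V}

lemma sum_innerCond_add_sum_rootCond (θ : Sym2 V → ℝ) :
    (∑ i, ∑ j, innerCond G v0 (expWeight G θ) i j) / 2 + ∑ i, rootCond G v0 (expWeight G θ) i =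
      ∑ e ∈ G.edgeFinset, exp (θ e) := by
  have h := sum_vw G (expWeight G θ)
  have h1 : ∑ e ∈ G.edgeFinset, expWeight G θ e = ∑ e ∈ G.edgeFinset, exp (θ e) :=
    Finset.sum_congr rfl fun e he => if_pos he
  have h0 : condMat G (expWeight G θ) v0 v0 = 0 := by simp [condMat]
  simp only [h1, vw_eq_sum_condMat, sum_eq_add_sum_subtype_ne v0, h0, zero_add,
    Finset.sum_add_distrib] at h
  simp only [innerCond, Matrix.of_apply, rootCond]
  simp only [condMat_comm G _ v0] at h
  linarith

lemma lintegral_liftedDensity_le (he0 : e0 ∈ G.edgeFinset) (a : Sym2 V → ℝ)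
    (ha : ∀ e ∈ G.edgeFinset, 0 < a e) :
    ∫⁻ t : Epin G e0 → ℝ, ∫⁻ l : ℝ, ∫⁻ u,
        ENNReal.ofReal (liftedDensity G v0 a (joinLog G e0 0 t) l u) ≤
      ENNReal.ofReal (√(2 * π) ^ Fintype.card {v // v ≠ v0} *
        ∏ e ∈ G.edgeFinset, Gamma (a e)) := by
  let θ : ℝ → (Epin G e0 → ℝ) → ({v // v ≠ v0} → ℝ) → Sym2 V → ℝ := fun l s y =>
    joinLog G e0 0 (s + fun i : Epin G e0 => ssum (extendZero v0 y) i - (l + ssum (extendZero v0 y) e0))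
  have hF : Continuous fun p : (Epin G e0 → ℝ) × ℝ × ({v // v ≠ v0} → ℝ) =>
      liftedDensity G v0 a (joinLog G e0 0 p.1) p.2.1 p.2.2 :=
    continuous_liftedDensity G v0 a (continuous_joinLog G e0 continuous_const continuous_fst)
      (by fun_prop) (by fun_prop)
  have hd : Continuous fun y : {v // v ≠ v0} → ℝ => ssum (extendZero v0 y) e0 :=
    continuous_ssum (continuous_extendZero v0 continuous_id) e0
  have hc : Continuous fun p : ℝ × ({v // v ≠ v0} → ℝ) =>
      fun i : Epin G e0 => ssum (extendZero v0 p.2) i - p.1 :=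
    continuous_pi fun i =>
      (continuous_ssum (continuous_extendZero v0 continuous_snd) _).sub continuous_fst
  rw [lintegral_gauge _ hF.measurable.ennreal_ofReal _ hd.measurable (fun l y (i : Epin G e0) =>
    ssum (extendZero v0 y) i - l) hc.measurable]
  calc ∫⁻ l : ℝ, ∫⁻ s : Epin G e0 → ℝ, ∫⁻ y : {v // v ≠ v0} → ℝ,
        ENNReal.ofReal (liftedDensity G v0 a (θ l s y) (l + ssum (extendZero v0 y) e0)
          fun i => y i - (l + ssum (extendZero v0 y) e0) / 2)
    _ ≤ ∫⁻ l : ℝ, ∫⁻ s : Epin G e0 → ℝ,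
        ENNReal.ofReal (∏ e ∈ G.edgeFinset, exp (a e * joinLog G e0 l s e)) *
        ENNReal.ofReal (√(2 * π) ^ Fintype.card {v // v ≠ v0} *
          exp (-∑ e ∈ G.edgeFinset, exp (joinLog G e0 l s e))) := by
        refine lintegral_mono fun l => lintegral_mono fun s => ?_
        have hθΘ : ∀ y, ∀ e ∈ G.edgeFinset, θ l s y e = joinLog G e0 l s e +
            ssum (extendZero v0 y) e - (l + ssum (extendZero v0 y) e0) := by
          intro y e he
          by_cases h : e = e0
          · simp only [h, θ, joinLog_self]
            ring
          · have h1 := joinLog_coe G e0 l s ⟨e, he, h⟩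
            dsimp only at h1
            have h2 := joinLog_coe G e0 0 (s + fun i : Epin G e0 => ssum (extendZero v0 y) i -
              (l + ssum (extendZero v0 y) e0)) ⟨e, he, h⟩
            dsimp only at h2
            rw [h1]
            exact h2.trans (by simp only [Pi.add_apply]; ring)
        refine (lintegral_mono fun y => ENNReal.ofReal_le_ofReal
          (liftedDensity_le G v0 a (hθΘ y))).trans ?_
        rw [← exp_sum]
        simp_rw [ENNReal.ofReal_mul (exp_pos _).le]
        rw [lintegral_const_mul' _ _ ENNReal.ofReal_ne_top]
        gcongr
        refine (lintegral_fieldDensity_le (innerCond G v0 _) (rootCond G v0 _) (fun i j => condMat_comm G _ _ _)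
          (fun i j => condMat_nonneg G _ _ _) fun i => condMat_nonneg G _ _ _).trans_eq ?_
        rw [sum_innerCond_add_sum_rootCond]
    _ = ∫⁻ l : ℝ, ∫⁻ s : Epin G e0 → ℝ,
        ENNReal.ofReal (√(2 * π) ^ Fintype.card {v // v ≠ v0} * exp (a e0 * l - 1 * exp l)) *
          ENNReal.ofReal (∏ i : Epin G e0, exp (a i * s i - 1 * exp (s i))) := by
        refine lintegral_congr fun l => lintegral_congr fun s => ?_
        rw [← ENNReal.ofReal_mul (by positivity), ← ENNReal.ofReal_mul (by positivity)]
        congr 1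
        rw [← Finset.sum_neg_distrib, exp_sum, mul_left_comm, ← Finset.prod_mul_distrib,
          prod_edgeFinset_eq_mul G he0, joinLog_self]
        simp only [joinLog_coe, ← exp_add, one_mul, sub_eq_add_neg]
        ring
    _ = _ := by
        have hs : ∫⁻ s : Epin G e0 → ℝ,
            ENNReal.ofReal (∏ i : Epin G e0, exp (a i * s i - 1 * exp (s i))) =
            ENNReal.ofReal (∏ i : Epin G e0, Gamma (a i)) := by
          refine lintegral_pi_ofReal_prod (fun (i : Epin G e0) x => exp (a i * x - 1 * exp x)) _ ?_ ?_ ?_ ?_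
          · intro i
            fun_prop
          · intro i x
            positivity
          · intro i
            exact (Gamma_pos_of_pos (ha i i.2.1)).le
          · intro i
            rw [lintegral_exp_mul_sub_exp (ha i i.2.1) one_pos]
            simp
        simp_rw [lintegral_const_mul' _ _ ENNReal.ofReal_ne_top, hs]
        rw [lintegral_mul_const' _ _ ENNReal.ofReal_ne_top]
        simp_rw [ENNReal.ofReal_mul (pow_nonneg (Real.sqrt_nonneg _) _)]
        rw [lintegral_const_mul' _ _ ENNReal.ofReal_ne_top,
          lintegral_exp_mul_sub_exp (ha e0 he0) one_pos, one_rpow, inv_one, mul_one, prod_edgeFinset_eq_mul G he0,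
          ENNReal.ofReal_mul (Gamma_pos_of_pos (ha e0 he0)).le]
        rw [mul_assoc]

end Mass

section MixingMass

variable (G : SimpleGraph V) [DecidableRel G.Adj] (v0 : V) {e0 : Sym2 V}

lemma vw_nonneg {a : Sym2 V → ℝ} (ha : ∀ e ∈ G.edgeFinset, 0 < a e) (v : V) : 0 ≤ vw G a v :=
  Finset.sum_nonneg fun j hj => (ha _ (by simpa using hj)).le

lemma bwt_root (a : Sym2 V → ℝ) : bwt G v0 a v0 = vw G a v0 / 2 := by
  simp [bwt]

lemma bwt_coe (a : Sym2 V → ℝ) (i : {v // v ≠ v0}) : bwt G v0 a i = (vw G a i + 1) / 2 := by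
  simp [bwt, i.2]

lemma bwt_pos (hadj : ∀ v, ∃ u, G.Adj v u) {a : Sym2 V → ℝ} (ha : ∀ e ∈ G.edgeFinset, 0 < a e)
    (v : V) : 0 < bwt G v0 a v := by
  have := vw_pos G hadj ha v
  unfold bwt
  split_ifs <;> linarith

lemma lintegral_liftedDensity (hadj : ∀ v, ∃ u, G.Adj v u) (a θ : Sym2 V → ℝ)
    (ha : ∀ e ∈ G.edgeFinset, 0 < a e) :
    ∫⁻ l : ℝ, ∫⁻ u, ENNReal.ofReal (liftedDensity G v0 a θ l u) =
      ENNReal.ofReal (exp (∑ e ∈ G.edgeFinset, a e * θ e) * √(tau G (expWeight G θ)) *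
        (∏ v, Gamma (bwt G v0 a v) * ((vw G (expWeight G θ) v / 2) ^ bwt G v0 a v)⁻¹) /
          2 ^ Fintype.card {v // v ≠ v0}) := by
  have hw : ∀ v, 0 < vw G (expWeight G θ) v / 2 := fun v =>
    half_pos (vw_pos G hadj (fun e he => expWeight_pos G θ he) v)
  set w := vw G (expWeight G θ)
  set K := exp (∑ e ∈ G.edgeFinset, a e * θ e) * √(tau G (expWeight G θ)) with hK
  have hK0 : 0 ≤ K := by positivity
  set b := bwt G v0 a
  have hb : ∀ v, 0 < b v := bwt_pos G v0 hadj ha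
  have hfac : ∀ l u, liftedDensity G v0 a θ l u = K * exp (b v0 * l - w v0 / 2 * exp l) *
      ∏ i : {v // v ≠ v0}, exp (-(2 * b i * u i) - w i / 2 * exp (-(2 * u i))) := by
    intro l u
    rw [← exp_sum, hK, mul_assoc _ (√_), mul_comm (√_), mul_assoc _ _ (rexp _), mul_right_comm _ (√_),
      ← mul_assoc, ← exp_add, ← exp_add, liftedDensity]
    congr 2
    have h1 : ∑ i : {v // v ≠ v0}, (-(2 * b i * u i) - w i / 2 * exp (-(2 * u i))) =
        -(∑ i : {v // v ≠ v0}, (vw G a i + 1) * u i) -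
          (∑ i : {v // v ≠ v0}, w i * exp (-(2 * u i))) / 2 := by
      rw [Finset.sum_sub_distrib, Finset.sum_neg_distrib, Finset.sum_div]
      congr 2
      · refine Finset.sum_congr rfl fun i _ => ?_
        simp only [b, bwt_coe]
        ring
      · ext i
        ring
    rw [h1]
    simp only [b, bwt_root]
    ring
  have hu : ∫⁻ u : {v // v ≠ v0} → ℝ, ENNReal.ofReal
      (∏ i : {v // v ≠ v0}, exp (-(2 * b i * u i) - w i / 2 * exp (-(2 * u i)))) =
      ENNReal.ofReal (∏ i : {v // v ≠ v0}, Gamma (b i) * ((w i / 2) ^ b i)⁻¹ / 2) := by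
    refine lintegral_pi_ofReal_prod
      (fun (i : {v // v ≠ v0}) x => exp (-(2 * b i * x) - w i / 2 * exp (-(2 * x)))) _ ?_ ?_ ?_ ?_
    · intro i
      fun_prop
    · intro i x
      positivity
    · intro i
      have := Gamma_pos_of_pos (hb i)
      have := rpow_pos_of_pos (hw i) (b i)
      positivity
    · intro i
      exact lintegral_exp_neg_two_mul_sub_exp (hb i) (hw i)
  have hG0 := Gamma_pos_of_pos (hb v0)
  have hp0 := rpow_pos_of_pos (hw v0) (b v0)
  calc ∫⁻ l : ℝ, ∫⁻ u, ENNReal.ofReal (liftedDensity G v0 a θ l u)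
      = ∫⁻ l : ℝ, ENNReal.ofReal K * ENNReal.ofReal (exp (b v0 * l - w v0 / 2 * exp l)) *
          ENNReal.ofReal (∏ i : {v // v ≠ v0}, Gamma (b i) * ((w i / 2) ^ b i)⁻¹ / 2) := by
        refine lintegral_congr fun l => ?_
        simp_rw [hfac]
        rw [← hu, ← ENNReal.ofReal_mul hK0, ← lintegral_const_mul' _ _ ENNReal.ofReal_ne_top]
        refine lintegral_congr fun u => ENNReal.ofReal_mul (by positivity)
    _ = _ := by
        rw [lintegral_mul_const' _ _ ENNReal.ofReal_ne_top,
          lintegral_const_mul' _ _ ENNReal.ofReal_ne_top,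
          lintegral_exp_mul_sub_exp (hb v0) (hw v0), ← ENNReal.ofReal_mul hK0,
          ← ENNReal.ofReal_mul (by positivity), prod_eq_mul_prod_subtype_ne v0,
          Finset.prod_div_distrib, Finset.prod_const, Finset.card_univ]
        congr 1
        ring

lemma Znorm_mul_eq (hadj : ∀ v, ∃ u, G.Adj v u) (a : Sym2 V → ℝ)
    (ha : ∀ e ∈ G.edgeFinset, 0 < a e) :
    Znorm G v0 a * ((∏ v, Gamma (bwt G v0 a v) * 2 ^ bwt G v0 a v) /
        2 ^ Fintype.card {v // v ≠ v0}) =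
      √(2 * π) ^ Fintype.card {v // v ≠ v0} * ∏ e ∈ G.edgeFinset, Gamma (a e) := by
  have hr : (Fintype.card V : ℝ) = Fintype.card {v // v ≠ v0} + 1 := by
    have h : Fintype.card V = Fintype.card {v // v ≠ v0} + 1 := by
      have : 0 < Fintype.card V := Fintype.card_pos_iff.2 ⟨v0⟩
      rw [Fintype.card_subtype_compl, Fintype.card_subtype_eq]
      omega
    exact_mod_cast h
  set r := Fintype.card {v // v ≠ v0}
  have hb : ∑ v, bwt G v0 a v = ∑ e ∈ G.edgeFinset, a e + (r : ℝ) / 2 := by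
    have h := sum_vw G a
    have h2 : ∑ v, bwt G v0 a v = (∑ v, vw G a v + Fintype.card V - 1) / 2 := by
      simp [bwt, ← Finset.sum_div, Finset.sum_sub_distrib, Finset.sum_add_distrib]
    rw [h2, h, hr]
    ring
  have hG : ∏ v, Gamma (bwt G v0 a v) ≠ 0 := Finset.prod_ne_zero_iff.2 fun v _ =>
    (Gamma_pos_of_pos (bwt_pos G v0 hadj ha v)).ne'
  have h2 : ∏ v, (2 : ℝ) ^ bwt G v0 a v =
      2 ^ (∑ e ∈ G.edgeFinset, a e) * 2 ^ ((r : ℝ) / 2) := by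
    rw [← rpow_sum_of_pos two_pos, hb, rpow_add two_pos]
  have hs : √(2 * π) ^ r = 2 ^ ((r : ℝ) / 2) * π ^ ((r : ℝ) / 2) := by
    rw [sqrt_eq_rpow, ← rpow_mul_natCast (by positivity), mul_rpow two_pos.le pi_pos.le]
    ring_nf
  have h3 : (2 : ℝ) ^ (1 - (r + 1 : ℝ) + ∑ e ∈ G.edgeFinset, a e) * 2 ^ r =
      2 ^ (∑ e ∈ G.edgeFinset, a e) := by
    rw [← rpow_natCast, ← rpow_add two_pos]
    ring_nf
  rw [Znorm, Finset.prod_mul_distrib, h2, hs, hr, ← h3, add_sub_cancel_right]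
  have h4 : (2 : ℝ) ^ (1 - (r + 1 : ℝ) + ∑ e ∈ G.edgeFinset, a e) ≠ 0 :=
    (rpow_pos_of_pos two_pos _).ne'
  field_simp

lemma magicDensity_mul_prod_exp (hadj : ∀ v, ∃ u, G.Adj v u) (he0 : e0 ∈ G.edgeFinset)
    (a : Sym2 V → ℝ) (t : Epin G e0 → ℝ) :
    magicDensity G v0 a (expWeight G (joinLog G e0 0 t)) * ∏ i, exp (t i) =
      (Znorm G v0 a)⁻¹ * (exp (∑ e ∈ G.edgeFinset, a e * joinLog G e0 0 t e) *
        √(tau G (expWeight G (joinLog G e0 0 t))) *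
        ∏ v, (vw G (expWeight G (joinLog G e0 0 t)) v ^ bwt G v0 a v)⁻¹) := by
  set θ := joinLog G e0 0 t with hθ
  have hw : ∀ v, 0 < vw G (expWeight G θ) v := fun v =>
    vw_pos G hadj (fun e he => expWeight_pos G θ he) v
  have h1 : (∏ e ∈ G.edgeFinset, expWeight G θ e ^ (a e - 1)) * ∏ i, exp (t i) =
      exp (∑ e ∈ G.edgeFinset, a e * θ e) := by
    have h2 : ∏ i, exp (t i) = ∏ e ∈ G.edgeFinset, exp (θ e) := by
      rw [prod_edgeFinset_eq_mul G he0, hθ, joinLog_self, exp_zero, one_mul]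
      simp only [joinLog_coe]
    rw [h2, ← Finset.prod_mul_distrib, exp_sum]
    refine Finset.prod_congr rfl fun e he => ?_
    rw [expWeight, if_pos he, ← exp_mul, ← exp_add]
    ring_nf
  have h3 : vw G (expWeight G θ) v0 ^ (1 / 2 : ℝ) /
      (∏ v : V, (vw G (expWeight G θ) v) ^ ((vw G a v + 1) / 2)) =
      ∏ v, (vw G (expWeight G θ) v ^ bwt G v0 a v)⁻¹ := by
    rw [prod_eq_mul_prod_subtype_ne v0, prod_eq_mul_prod_subtype_ne v0, ← div_div, ← rpow_sub (hw v0),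
      bwt_root, div_eq_mul_inv, ← Finset.prod_inv_distrib, ← rpow_neg (hw v0).le]
    simp only [bwt_coe]
    ring_nf
  rw [magicDensity, ← h1, ← h3]
  ring

lemma measurable_pinExt (e0 : Sym2 V) : Measurable (pinExt G e0) := by
  refine measurable_pi_iff.2 fun e => ?_
  unfold pinExt
  split_ifs
  · exact measurable_const
  · exact measurable_pi_apply _
  · exact measurable_const

lemma forall_pinExt_pos_iff (u : Epin G e0 → ℝ) :
    (∀ e ∈ G.edgeFinset, 0 < pinExt G e0 u e) ↔ ∀ i, 0 < u i := by
  refine ⟨fun h i => ?_, fun h e he => ?_⟩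
  · have := h i i.2.1
    rwa [pinExt, if_neg i.2.2, dif_pos i.2] at this
  · unfold pinExt
    split_ifs with h1 h2
    · exact one_pos
    · exact h _
    · exact absurd ⟨he, h1⟩ h2

lemma ae_mixing_pos (a : Sym2 V → ℝ) :
    ∀ᵐ w ∂mixing G e0 v0 a, ∀ e ∈ G.edgeFinset, 0 < w e := by
  have hm : MeasurableSet {w : Sym2 V → ℝ | ∀ e ∈ G.edgeFinset, 0 < w e} := by
    have : {w : Sym2 V → ℝ | ∀ e ∈ G.edgeFinset, 0 < w e} =
        ⋂ e ∈ G.edgeFinset, {w | 0 < w e} := by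
      ext w
      simp
    rw [this]
    exact G.edgeFinset.measurableSet_biInter fun e _ =>
      measurableSet_lt measurable_const (measurable_pi_apply e)
  rw [mixing, ae_map_iff (measurable_pinExt G e0).aemeasurable hm, ae_iff]
  have hset : {u : Epin G e0 → ℝ | ¬ ∀ e ∈ G.edgeFinset, 0 < pinExt G e0 u e} =
    (pinExt G e0 ⁻¹' {w | ∀ e ∈ G.edgeFinset, 0 < w e})ᶜ := rfl
  rw [hset, withDensity_apply _ (measurable_pinExt G e0 hm).compl]
  refine (setLIntegral_congr_fun (measurable_pinExt G e0 hm).compl fun u hu => ?_).trans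
    lintegral_zero
  have hu' : ¬ ∀ e ∈ G.edgeFinset, 0 < pinExt G e0 u e := hu
  simp only [if_neg hu', ENNReal.ofReal_zero]

lemma mixing_univ_le_one (hadj : ∀ v, ∃ u, G.Adj v u) (he0 : e0 ∈ G.edgeFinset)
    (a : Sym2 V → ℝ) (ha : ∀ e ∈ G.edgeFinset, 0 < a e) :
    mixing G e0 v0 a Set.univ ≤ 1 := by
  set C := (∏ v, Gamma (bwt G v0 a v) * 2 ^ bwt G v0 a v) / 2 ^ Fintype.card {v // v ≠ v0}
  have hCpos : 0 < C := by
    have : ∀ v, 0 < Gamma (bwt G v0 a v) * 2 ^ bwt G v0 a v := fun v =>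
      mul_pos (Gamma_pos_of_pos (bwt_pos G v0 hadj ha v)) (rpow_pos_of_pos two_pos _)
    have := Finset.prod_pos fun v (_ : v ∈ Finset.univ) => this v
    positivity
  have hZ := Znorm_mul_eq G v0 hadj a ha
  change Znorm G v0 a * C = _ at hZ
  have hΓ : 0 < ∏ e ∈ G.edgeFinset, Gamma (a e) :=
    Finset.prod_pos fun e he => Gamma_pos_of_pos (ha e he)
  have hZC : 0 < Znorm G v0 a * C := by
    rw [hZ]
    positivity
  have hset : {u : Epin G e0 → ℝ | ∀ i, 0 < u i} = ⋂ i, {u | 0 < u i} := by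
    ext u
    simp
  have hms : MeasurableSet {u : Epin G e0 → ℝ | ∀ i, 0 < u i} := by
    rw [hset]
    exact MeasurableSet.iInter fun i => measurableSet_lt measurable_const (measurable_pi_apply i)
  calc mixing G e0 v0 a Set.univ
      = ∫⁻ u : Epin G e0 → ℝ in {u | ∀ i, 0 < u i},
          ENNReal.ofReal (magicDensity G v0 a (pinExt G e0 u)) := by
        rw [mixing, Measure.map_apply (measurable_pinExt G e0) MeasurableSet.univ,
          Set.preimage_univ, withDensity_apply _ MeasurableSet.univ, setLIntegral_univ,
          ← lintegral_indicator hms]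
        refine lintegral_congr fun u => ?_
        simp only [forall_pinExt_pos_iff, Set.indicator_apply, Set.mem_ofPred_eq]
        split_ifs <;> simp
    _ = ∫⁻ t : Epin G e0 → ℝ, ENNReal.ofReal (∏ i, exp (t i)) * ENNReal.ofReal
          (magicDensity G v0 a (expWeight G (joinLog G e0 0 t))) := by
        rw [lintegral_pi_pos_eq_lintegral_exp]
        simp_rw [pinExt_exp G he0]
    _ = ∫⁻ t : Epin G e0 → ℝ, ENNReal.ofReal (Znorm G v0 a * C)⁻¹ * ∫⁻ l : ℝ, ∫⁻ u,
          ENNReal.ofReal (liftedDensity G v0 a (joinLog G e0 0 t) l u) := by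
        refine lintegral_congr fun t => ?_
        rw [lintegral_liftedDensity G v0 hadj a _ ha, ← ENNReal.ofReal_mul (by positivity),
          ← ENNReal.ofReal_mul (by positivity), mul_comm (∏ i, _),
          magicDensity_mul_prod_exp G v0 hadj he0, mul_inv, mul_assoc (Znorm G v0 a)⁻¹]
        congr 2
        have hsplit : ∏ v, Gamma (bwt G v0 a v) *
            ((vw G (expWeight G (joinLog G e0 0 t)) v / 2) ^ bwt G v0 a v)⁻¹ =
            (∏ v, Gamma (bwt G v0 a v) * 2 ^ bwt G v0 a v) *
              ∏ v, (vw G (expWeight G (joinLog G e0 0 t)) v ^ bwt G v0 a v)⁻¹ := by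
          rw [← Finset.prod_mul_distrib]
          refine Finset.prod_congr rfl fun v _ => ?_
          have := vw_pos G hadj (fun e he => expWeight_pos G (joinLog G e0 0 t) he) v
          rw [div_rpow this.le two_pos.le, inv_div, div_eq_mul_inv, mul_assoc]
        rw [hsplit, mul_left_comm _ (∏ v, Gamma (bwt G v0 a v) * 2 ^ bwt G v0 a v), mul_div_right_comm]
        change _ = C⁻¹ * (C * _)
        rw [inv_mul_cancel_left₀ hCpos.ne']
    _ ≤ ENNReal.ofReal (Znorm G v0 a * C)⁻¹ * ENNReal.ofReal (Znorm G v0 a * C) := by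
        rw [lintegral_const_mul' _ _ ENNReal.ofReal_ne_top, hZ]
        gcongr
        exact lintegral_liftedDensity_le G v0 he0 a ha
    _ = 1 := by
        rw [← ENNReal.ofReal_mul (by positivity), inv_mul_cancel₀ hZC.ne', ENNReal.ofReal_one]

end MixingMass

section Information

variable {Ω X : Type*} [MeasurableSpace Ω] [Fintype X] [MeasurableSpace X]
  [MeasurableSingletonClass X] {μ : Measure Ω} {p : X → Ω → ℝ}
  {J : Measure (Ω × X)}

lemma joint_apply
    (hJ : J = ∑ x, (μ.withDensity fun w => ENNReal.ofReal (p x w)).map fun w => (w, x))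
    {s : Set (Ω × X)} (hs : MeasurableSet s) :
    J s = ∑ x, ∫⁻ w, ENNReal.ofReal (p x w) * s.indicator 1 (w, x) ∂μ := by
  rw [hJ, Measure.finsetSum_apply]
  refine Finset.sum_congr rfl fun x _ => ?_
  have hx : Measurable fun w : Ω => (w, x) := by fun_prop
  rw [Measure.map_apply hx hs, withDensity_apply _ (hx hs), ← lintegral_indicator (hx hs)]
  refine lintegral_congr fun w => ?_
  by_cases h : (w, x) ∈ s <;> simp [h]

lemma joint_fst (hp : ∀ x, Measurable (p x)) (hp0 : ∀ᵐ w ∂μ, ∀ x, 0 ≤ p x w)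
    (hp1 : ∀ᵐ w ∂μ, ∑ x, p x w = 1)
    (hJ : J = ∑ x, (μ.withDensity fun w => ENNReal.ofReal (p x w)).map fun w => (w, x)) :
    J.map Prod.fst = μ := by
  ext s hs
  rw [Measure.map_apply measurable_fst hs, joint_apply hJ (measurable_fst hs),
    ← lintegral_finsetSum]
  · rw [← lintegral_indicator_one hs]
    refine lintegral_congr_ae ?_
    filter_upwards [hp0, hp1] with w h0 h1
    have : ∀ x : X, (Prod.fst ⁻¹' s : Set (Ω × X)).indicator (1 : Ω × X → ℝ≥0∞) (w, x) =
        s.indicator 1 w := fun x => by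
      by_cases h : w ∈ s <;> simp [h]
    simp_rw [this]
    rw [← Finset.sum_mul, ← ENNReal.ofReal_sum_of_nonneg fun x _ => h0 x, h1]
    simp
  · intro x _
    refine (hp x).ennreal_ofReal.mul ?_
    exact (measurable_one.indicator (measurable_fst hs)).comp (by fun_prop)

lemma joint_snd_singleton
    (hJ : J = ∑ x, (μ.withDensity fun w => ENNReal.ofReal (p x w)).map fun w => (w, x)) (x : X) :
    J.map Prod.snd {x} = ∫⁻ w, ENNReal.ofReal (p x w) ∂μ := by
  rw [Measure.map_apply measurable_snd (measurableSet_singleton x),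
    joint_apply hJ (measurable_snd (measurableSet_singleton x)),
    Finset.sum_eq_single x]
  · simp
  · intro y _ hy
    simp [hy]
  · simp

lemma joint_eq_withDensity [IsFiniteMeasure μ] [IsFiniteMeasure (J.map Prod.snd)]
    (hp : ∀ x, Measurable (p x))
    (hJ : J = ∑ x, (μ.withDensity fun w => ENNReal.ofReal (p x w)).map fun w => (w, x)) :
    J = (μ.prod (J.map Prod.snd)).withDensity fun z =>
      ENNReal.ofReal (p z.2 z.1) / J.map Prod.snd {z.2} := by
  have hf : Measurable fun z : Ω × X => ENNReal.ofReal (p z.2 z.1) / J.map Prod.snd {z.2} :=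
    measurable_from_prod_countable_left fun x => by
      dsimp only
      exact (hp x).ennreal_ofReal.div_const _
  ext s hs
  rw [joint_apply hJ hs, withDensity_apply _ hs, ← lintegral_indicator hs,
    lintegral_prod_symm' _ (hf.indicator hs), lintegral_fintype]
  refine Finset.sum_congr rfl fun x _ => ?_
  rw [← lintegral_mul_const' _ _ (measure_ne_top _ _)]
  refine lintegral_congr_ae ?_
  by_cases hx : J.map Prod.snd {x} = 0
  · have h0 := hx
    rw [joint_snd_singleton hJ, lintegral_eq_zero_iff (hp x).ennreal_ofReal] at h0
    filter_upwards [h0] with w hw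
    rw [hw, hx]
    simp
  · refine .of_forall fun w => ?_
    by_cases h : (w, x) ∈ s
    · simp only [h, Set.indicator_of_mem, Pi.one_apply, mul_one]
      rw [ENNReal.div_mul_cancel hx (measure_ne_top _ _)]
    · simp [h]

lemma KL_joint_le (hμ : μ Set.univ ≤ 1) (hp : ∀ x, Measurable (p x))
    (hp0 : ∀ᵐ w ∂μ, ∀ x, 0 ≤ p x w) (hp1 : ∀ᵐ w ∂μ, ∑ x, p x w = 1) (q : X → ℝ)
    (hq : ∀ᵐ w ∂μ, ∀ x, p x w ≤ q x) (hq0 : ∀ x, 0 ≤ q x) {K : ℝ} (hK : 1 ≤ K)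
    (hqK : ∑ x, q x ≤ K)
    (hJ : J = ∑ x, (μ.withDensity fun w => ENNReal.ofReal (p x w)).map fun w => (w, x)) :
    KL J ((J.map Prod.fst).prod (J.map Prod.snd)) ≤ ((log K + 1 / 2 : ℝ) : EReal) := by
  have hfst := joint_fst hp hp0 hp1 hJ
  have hJμ : J Set.univ = μ Set.univ := by
    rw [← hfst, Measure.map_apply measurable_fst MeasurableSet.univ, Set.preimage_univ]
  have : IsFiniteMeasure μ := ⟨hμ.trans_lt ENNReal.one_lt_top⟩
  have : IsFiniteMeasure J := ⟨by rw [hJμ]; exact measure_lt_top _ _⟩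
  rw [hfst]
  have hdens := joint_eq_withDensity hp hJ
  set ν := J.map Prod.snd with hν
  set f : Ω × X → ℝ≥0∞ := fun z => ENNReal.ofReal (p z.2 z.1) / ν {z.2} with hfdef
  have hf : Measurable f := measurable_from_prod_countable_left fun x => by
    simp only [hfdef]
    exact (hp x).ennreal_ofReal.div_const _
  have hac : J ≪ μ.prod ν := by
    rw [hdens]
    exact withDensity_absolutelyContinuous _ _
  have hrn : J.rnDeriv (μ.prod ν) =ᵐ[J] f := by
    refine hac.ae_le ?_
    conv in J.rnDeriv _ => rw [hdens]
    exact Measure.rnDeriv_withDensity _ hf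
  rw [KL, if_pos hac, EReal.coe_le_coe_iff]
  set g : Ω × X → ℝ := fun z => log (J.rnDeriv (μ.prod ν) z).toReal with hg
  by_cases hgi : Integrable g J
  swap
  · rw [integral_undef hgi]
    have := log_nonneg hK
    positivity
  have hK0 : 0 < K := one_pos.trans_le hK
  set h : X → ℝ := fun x => q x / ν.real {x} / (2 * K) + (log (2 * K) - 1) with hh
  have hle : g ≤ᵐ[J] fun z => h z.2 := by
    have h1 : ∀ᵐ z ∂J, f z ≠ 0 ∧ ν {z.2} ≠ 0 ∧ p z.2 z.1 ≤ q z.2 := by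
      have h2 : ∀ᵐ z ∂μ.prod ν, ν {z.2} ≠ 0 :=
        Measure.quasiMeasurePreserving_snd.ae (p := fun x => ν {x} ≠ 0) (ae_iff_of_countable.2
          fun x hx => hx)
      have h3 : ∀ᵐ z ∂μ.prod ν, ∀ x, p x z.1 ≤ q x :=
        Measure.quasiMeasurePreserving_fst.ae hq
      rw [hdens, ae_withDensity_iff hf]
      filter_upwards [h2, h3] with z hz hz' hfz
      exact ⟨hfz, hz, hz' _⟩
    filter_upwards [h1, hrn] with z ⟨hz1, hz2, hz3⟩ hz4
    have hν0 : 0 < ν.real {z.2} := ENNReal.toReal_pos hz2 (measure_ne_top _ _)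
    have hpz : 0 < p z.2 z.1 := by
      by_contra! hneg
      exact hz1 (by simp [hfdef, ENNReal.ofReal_of_nonpos hneg])
    have h5 : (f z).toReal = p z.2 z.1 / ν.real {z.2} := by
      rw [hfdef, ENNReal.toReal_div, ENNReal.toReal_ofReal hpz.le, Measure.real]
    have h6 : 0 < q z.2 / ν.real {z.2} := div_pos (hpz.trans_le hz3) hν0
    simp only [hg, hz4, h5, hh]
    calc log (p z.2 z.1 / ν.real {z.2}) ≤ log (q z.2 / ν.real {z.2}) := by
          gcongr
      _ = log (q z.2 / ν.real {z.2} / (2 * K)) + log (2 * K) := by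
          rw [← log_mul (by positivity) (by positivity), div_mul_cancel₀ _ (by positivity)]
      _ ≤ _ := by
          have := log_le_sub_one_of_pos (x := q z.2 / ν.real {z.2} / (2 * K)) (by positivity)
          linarith
  have hνJ : ν.real Set.univ = J.real Set.univ := by
    rw [Measure.real, hν, Measure.map_apply measurable_snd MeasurableSet.univ, Set.preimage_univ,
      Measure.real]
  have hc1 : ν.real Set.univ ≤ 1 := by
    rw [hνJ, Measure.real, hJμ]
    exact ENNReal.toReal_le_of_le_ofReal zero_le_one (by simpa using hμ)
  calc ∫ z, g z ∂J ≤ ∫ z, h z.2 ∂J := by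
        refine integral_mono_ae hgi ?_ hle
        exact Integrable.comp_measurable (g := h) (f := Prod.snd) .of_finite measurable_snd
    _ = ∫ x, h x ∂ν := by
        rw [hν, integral_map measurable_snd.aemeasurable]
        exact (measurable_of_finite h).aestronglyMeasurable
    _ = ∑ x, ν.real {x} * h x := by
        rw [integral_fintype .of_finite]
        simp
    _ ≤ ∑ x, (q x / (2 * K) + ν.real {x} * (log (2 * K) - 1)) := by
        refine Finset.sum_le_sum fun x _ => ?_
        simp only [hh, mul_add]
        gcongr
        rcases eq_or_ne (ν.real {x}) 0 with h0 | h0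
        · rw [h0, zero_mul]
          have := hq0 x
          positivity
        · rw [mul_div_assoc', mul_div_cancel₀ _ h0]
    _ = (∑ x, q x) / (2 * K) + ν.real Set.univ * (log (2 * K) - 1) := by
        rw [Finset.sum_add_distrib, ← Finset.sum_div, ← Finset.sum_mul]
        congr 2
        rw [← Finset.coe_univ, ← sum_measureReal_singleton]
    _ ≤ log K + 1 / 2 := by
        have h1 : (∑ x, q x) / (2 * K) ≤ 1 / 2 := by
          rw [div_le_div_iff₀ (by positivity) two_pos]
          linarith
        have h2 : log 2 ≤ 1 := by
          have := log_two_lt_d9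
          linarith
        rw [log_mul two_ne_zero hK0.ne']
        have h3 := log_nonneg hK
        have h4 : 0 ≤ ν.real Set.univ := measureReal_nonneg
        nlinarith

end Information

lemma sum_path_eq_one {k : V → V → ℝ} (hk : ∀ i, ∑ j, k i j = 1) (v0 : V) (T : ℕ) :
    ∑ x : Fin (T + 1) → V,
      (if x 0 = v0 then ∏ t : Fin T, k (x t.castSucc) (x t.succ) else 0) = 1 := by
  induction T with
  | zero =>
    rw [← (Equiv.funUnique (Fin 1) V).symm.sum_comp]
    simp
  | succ T ih =>
    rw [← (Fin.snocEquiv fun _ => V).sum_comp, Fintype.sum_prod_type_right]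
    refine Eq.trans (Finset.sum_congr rfl fun x _ => ?_) ih
    have h : ∀ j : V, (if (Fin.snocEquiv fun _ : Fin (T + 2) => V) (j, x) 0 = v0 then
        ∏ t : Fin (T + 1), k ((Fin.snocEquiv fun _ : Fin (T + 2) => V) (j, x) t.castSucc)
          ((Fin.snocEquiv fun _ : Fin (T + 2) => V) (j, x) t.succ) else 0) =
        (if x 0 = v0 then ∏ t : Fin T, k (x t.castSucc) (x t.succ) else 0) *
          k (x (Fin.last T)) j := by
      intro j
      have h0 : (Fin.snoc x j : Fin (T + 2) → V) 0 = x 0 := by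
        rw [← Fin.castSucc_zero, Fin.snoc_castSucc (α := fun _ => V)]
      simp only [Fin.snocEquiv_apply, h0]
      rw [Fin.prod_univ_castSucc]
      simp only [← Fin.castSucc_succ, Fin.snoc_castSucc (α := fun _ => V), Fin.succ_last,
        Fin.snoc_last (α := fun _ => V)]
      split_ifs <;> simp
    simp_rw [h]
    rw [← Finset.mul_sum, hk, mul_one]

lemma sum_qstep (G : SimpleGraph V) [DecidableRel G.Adj] (w : Sym2 V → ℝ) {i : V}
    (hi : vw G w i ≠ 0) : ∑ j, qstep G w i j = 1 := by
  have h : ∀ j, qstep G w i j = condMat G w i j / vw G w i := fun j => by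
    unfold qstep condMat
    split_ifs <;> simp
  simp_rw [h]
  rw [← Finset.sum_div, ← vw_eq_sum_condMat, div_self hi]

lemma sum_quenchedProb (G : SimpleGraph V) [DecidableRel G.Adj] (v0 : V) (w : Sym2 V → ℝ)
    (hw : ∀ i, vw G w i ≠ 0) (T : ℕ) : ∑ x, quenchedProb G v0 w T x = 1 := by
  refine Eq.trans (Finset.sum_congr rfl fun x _ => ?_)
    (sum_path_eq_one (fun i => sum_qstep G w (hw i)) v0 T)
  rw [quenchedProb, Finset.prod_range]
  congr 1
  refine Finset.prod_congr rfl fun t _ => ?_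
  congr 1
  · exact dif_pos (t.2.trans (Nat.lt_succ_self T))
  · exact dif_pos (Nat.succ_lt_succ t.2)

section Types

variable (G : SimpleGraph V) [DecidableRel G.Adj]

lemma prod_range_eq_prod_pow_card {α : Type*} [DecidableEq α] (S : Finset α) (X : ℕ → α) (T : ℕ)
    (hX : ∀ t < T, X t ∈ S) (f : α → ℝ) :
    ∏ t ∈ Finset.range T, f (X t) =
      ∏ e ∈ S, f e ^ ((Finset.range T).filter fun k => X k = e).card := by
  rw [← Finset.prod_fiberwise_of_maps_to (s := Finset.range T) (t := S) (g := X)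
    (fun t ht => hX t (Finset.mem_range.1 ht))]
  refine Finset.prod_congr rfl fun e _ => ?_
  rw [Finset.prod_congr rfl (g := fun _ => f e), Finset.prod_const]
  intro t ht
  rw [(Finset.mem_filter.1 ht).2]

lemma two_mul_visits_add (X : ℕ → V) (T : ℕ) (hX : ∀ t < T, G.Adj (X t) (X (t + 1))) (v : V) :
    2 * ((Finset.range T).filter fun k => X k = v).card + (if X T = v then 1 else 0) =
      (∑ e ∈ G.edgeFinset, if v ∈ e then
        ((Finset.range T).filter fun k => s(X k, X (k + 1)) = e).card else 0) +
        if X 0 = v then 1 else 0 := by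
  have h1 : ∑ e ∈ G.edgeFinset, (if v ∈ e then
      ((Finset.range T).filter fun k => s(X k, X (k + 1)) = e).card else 0) =
      ((Finset.range T).filter fun k => X k = v).card +
        ((Finset.range T).filter fun k => X (k + 1) = v).card := by
    have h2 : ∀ e, (if v ∈ e then
        ((Finset.range T).filter fun k => s(X k, X (k + 1)) = e).card else 0) =
        ∑ k ∈ (Finset.range T).filter (fun k => s(X k, X (k + 1)) = e),
          if v ∈ s(X k, X (k + 1)) then 1 else 0 := by
      intro e
      rw [Finset.sum_congr rfl (g := fun _ => if v ∈ e then 1 else 0)]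
      · split_ifs <;> simp
      · intro k hk
        rw [(Finset.mem_filter.1 hk).2]
    simp_rw [h2]
    rw [Finset.sum_fiberwise_of_maps_to (s := Finset.range T) (t := G.edgeFinset)
      (g := fun k => s(X k, X (k + 1)))
      (fun k hk => by simpa using hX k (Finset.mem_range.1 hk)),
      Finset.card_filter, Finset.card_filter, ← Finset.sum_add_distrib]
    refine Finset.sum_congr rfl fun k hk => ?_
    have := G.ne_of_adj (hX k (Finset.mem_range.1 hk))
    by_cases h3 : X k = v
    · subst h3
      simp [this.symm]
    · simp [h3, eq_comm (a := v)]
  have h3 : ((Finset.range T).filter fun k => X k = v).card + (if X T = v then 1 else 0) =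
      ((Finset.range T).filter fun k => X (k + 1) = v).card + if X 0 = v then 1 else 0 := by
    rw [Finset.card_filter, Finset.card_filter, ← Finset.sum_range_succ, Finset.sum_range_succ']
  omega

lemma sum_card_edge_eq (X : ℕ → V) (T : ℕ) (hX : ∀ t < T, G.Adj (X t) (X (t + 1))) :
    ∑ e ∈ G.edgeFinset, ((Finset.range T).filter fun k => s(X k, X (k + 1)) = e).card = T := by
  rw [← Finset.card_eq_sum_card_fiberwise, Finset.card_range]
  intro k hk
  simpa using hX k (by simpa using hk)

/-- The quenched probability of a path depends only on its undirected edge counts. -/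
lemma prod_qstep_congr {e0 : Sym2 V} (he0 : e0 ∈ G.edgeFinset) {X Y : ℕ → V} {T : ℕ}
    (hX : ∀ t < T, G.Adj (X t) (X (t + 1))) (hY : ∀ t < T, G.Adj (Y t) (Y (t + 1)))
    (h0 : X 0 = Y 0) (h : ∀ e ∈ G.edgeFinset, e ≠ e0 →
      ((Finset.range T).filter fun k => s(X k, X (k + 1)) = e).card =
        ((Finset.range T).filter fun k => s(Y k, Y (k + 1)) = e).card) (w : Sym2 V → ℝ) :
    ∏ t ∈ Finset.range T, qstep G w (X t) (X (t + 1)) =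
      ∏ t ∈ Finset.range T, qstep G w (Y t) (Y (t + 1)) := by
  have hE : ∀ e ∈ G.edgeFinset, ((Finset.range T).filter fun k => s(X k, X (k + 1)) = e).card =
        ((Finset.range T).filter fun k => s(Y k, Y (k + 1)) = e).card := by
    intro e he
    by_cases hee : e = e0
    · subst hee
      have h1 := sum_card_edge_eq G X T hX
      have h2 := sum_card_edge_eq G Y T hY
      rw [sum_edgeFinset_eq_add G he] at h1 h2
      rw [Finset.sum_congr rfl fun (i : Epin G e) _ => h i i.2.1 i.2.2] at h1
      omega
    · exact h e he hee
  have hV : ∀ v, ((Finset.range T).filter fun k => X k = v).card =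
      ((Finset.range T).filter fun k => Y k = v).card := by
    intro v
    have h1 := two_mul_visits_add G X T hX v
    have h2 := two_mul_visits_add G Y T hY v
    rw [Finset.sum_congr rfl fun e he => by rw [hE e he], h0] at h1
    split_ifs at h1 h2 <;> omega
  have key : ∀ Z : ℕ → V, (∀ t < T, G.Adj (Z t) (Z (t + 1))) →
      ∏ t ∈ Finset.range T, qstep G w (Z t) (Z (t + 1)) =
      (∏ e ∈ G.edgeFinset, w e ^ ((Finset.range T).filter fun k => s(Z k, Z (k + 1)) = e).card) /
        ∏ v, vw G w v ^ ((Finset.range T).filter fun k => Z k = v).card := by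
    intro Z hZ
    rw [← prod_range_eq_prod_pow_card G.edgeFinset (fun k => s(Z k, Z (k + 1))) T
      (fun t ht => by simpa using hZ t ht), ← prod_range_eq_prod_pow_card Finset.univ Z T
      (fun t _ => Finset.mem_univ _), ← Finset.prod_div_distrib]
    refine Finset.prod_congr rfl fun t ht => ?_
    rw [qstep, if_pos (hZ t (Finset.mem_range.1 ht))]
  rw [key X hX, key Y hY]
  congr 1
  · exact Finset.prod_congr rfl fun e he => by rw [hE e he]
  · exact Finset.prod_congr rfl fun v _ => by rw [hV v]

/-- Paths from `v0` along edges of `G`. -/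
def graphPaths (v0 : V) (T : ℕ) : Finset (Fin (T + 1) → V) :=
  Finset.univ.filter fun x =>
    x 0 = v0 ∧ ∀ t < T, G.Adj (extendPath v0 x t) (extendPath v0 x (t + 1))

/-- Edge counts of a path away from the reference edge. -/
def pathType (v0 : V) (e0 : Sym2 V) {T : ℕ} (x : Fin (T + 1) → V) (e : Epin G e0) : Fin (T + 1) :=
  ⟨edgeCount v0 x e, Nat.lt_succ_of_le ((Finset.card_filter_le _ _).trans (Finset.card_range T).le)⟩

/-- Uniform distribution on the type class of a path. -/
def typeWeight (v0 : V) (e0 : Sym2 V) {T : ℕ} (x : Fin (T + 1) → V) : ℝ :=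
  if x ∈ graphPaths G v0 T then
    (((graphPaths G v0 T).filter fun y => pathType G v0 e0 y = pathType G v0 e0 x).card : ℝ)⁻¹
  else 0

variable {G} in
lemma quenchedProb_of_notMem {v0 : V} {T : ℕ} {x : Fin (T + 1) → V} (hx : x ∉ graphPaths G v0 T)
    (w : Sym2 V → ℝ) : quenchedProb G v0 w T x = 0 := by
  unfold quenchedProb
  split_ifs with h
  · simp only [graphPaths, Finset.mem_filter, Finset.mem_univ, true_and, not_and, not_forall] at hx
    obtain ⟨t, ht, hadj⟩ := hx h
    exact Finset.prod_eq_zero (Finset.mem_range.2 ht) (if_neg hadj)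
  · rfl

lemma quenchedProb_nonneg {v0 : V} {T : ℕ} (x : Fin (T + 1) → V) {w : Sym2 V → ℝ}
    (hw : ∀ e ∈ G.edgeFinset, 0 < w e) : 0 ≤ quenchedProb G v0 w T x := by
  unfold quenchedProb
  split_ifs
  · refine Finset.prod_nonneg fun t _ => ?_
    unfold qstep
    split_ifs with h
    · exact div_nonneg (hw _ (SimpleGraph.mem_edgeFinset.2 h)).le (vw_nonneg G hw _)
    · exact le_rfl
  · exact le_rfl

lemma quenchedProb_le_typeWeight (hadj : ∀ v, ∃ u, G.Adj v u) {e0 : Sym2 V}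
    (he0 : e0 ∈ G.edgeFinset) (v0 : V) {T : ℕ} (x : Fin (T + 1) → V) {w : Sym2 V → ℝ}
    (hw : ∀ e ∈ G.edgeFinset, 0 < w e) :
    quenchedProb G v0 w T x ≤ typeWeight G v0 e0 x := by
  by_cases hx : x ∈ graphPaths G v0 T
  swap
  · rw [quenchedProb_of_notMem hx, typeWeight, if_neg hx]
  set S := (graphPaths G v0 T).filter fun y => pathType G v0 e0 y = pathType G v0 e0 x with hS
  have hxS : x ∈ S := Finset.mem_filter.2 ⟨hx, rfl⟩
  have hpos : 0 < (S.card : ℝ) := by exact_mod_cast Finset.card_pos.2 ⟨x, hxS⟩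
  rw [typeWeight, if_pos hx, ← hS, ← one_div, le_div_iff₀ hpos, mul_comm, ← nsmul_eq_mul,
    ← Finset.sum_const]
  calc ∑ _y ∈ S, quenchedProb G v0 w T x = ∑ y ∈ S, quenchedProb G v0 w T y := by
        refine Finset.sum_congr rfl fun y hy => ?_
        obtain ⟨hy, hty⟩ := Finset.mem_filter.1 hy
        simp only [graphPaths, Finset.mem_filter, Finset.mem_univ, true_and] at hx hy
        rw [quenchedProb, quenchedProb, if_pos hx.1, if_pos hy.1]
        refine prod_qstep_congr G he0 hx.2 hy.2 ?_ ?_ w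
        · exact hx.1.trans hy.1.symm
        · intro e he hee
          exact (congrArg Fin.val (congrFun hty ⟨e, he, hee⟩)).symm
    _ ≤ ∑ y, quenchedProb G v0 w T y :=
        Finset.sum_le_sum_of_subset_of_nonneg (Finset.subset_univ _) fun y _ _ =>
          quenchedProb_nonneg G y hw
    _ = 1 := sum_quenchedProb G v0 w (fun i => (vw_pos G hadj hw i).ne') T

lemma sum_typeWeight_le {e0 : Sym2 V} (he0 : e0 ∈ G.edgeFinset) (v0 : V) (T : ℕ) :
    ∑ x : Fin (T + 1) → V, typeWeight G v0 e0 x ≤ ((T : ℝ) + 1) ^ (G.edgeFinset.card - 1) := by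
  have hcard : Fintype.card (Epin G e0) = G.edgeFinset.card - 1 := by
    rw [← Finset.card_erase_of_mem he0]
    exact Fintype.card_of_subtype _ (by simp [and_comm])
  calc ∑ x : Fin (T + 1) → V, typeWeight G v0 e0 x
      = ∑ x ∈ graphPaths G v0 T, (((graphPaths G v0 T).filter fun y =>
          pathType G v0 e0 y = pathType G v0 e0 x).card : ℝ)⁻¹ := by
        simp [typeWeight, Finset.sum_ite_mem]
    _ = ∑ τ : Epin G e0 → Fin (T + 1), ∑ x ∈ (graphPaths G v0 T).filter fun x =>
          pathType G v0 e0 x = τ, (((graphPaths G v0 T).filter fun y =>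
          pathType G v0 e0 y = pathType G v0 e0 x).card : ℝ)⁻¹ :=
        (Finset.sum_fiberwise _ _ _).symm
    _ ≤ ∑ τ : Epin G e0 → Fin (T + 1), 1 := by
        refine Finset.sum_le_sum fun τ _ => ?_
        rw [Finset.sum_congr rfl (g := fun _ => (((graphPaths G v0 T).filter fun y =>
          pathType G v0 e0 y = τ).card : ℝ)⁻¹), Finset.sum_const, nsmul_eq_mul]
        · exact mul_inv_le_one
        · intro x hx
          rw [(Finset.mem_filter.1 hx).2]
    _ = _ := by
        simp [hcard]

end Types

lemma measurable_quenchedProb (G : SimpleGraph V) [DecidableRel G.Adj] (v0 : V) {T : ℕ}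
    (x : Fin (T + 1) → V) : Measurable fun w => quenchedProb G v0 w T x := by
  unfold quenchedProb qstep vw
  split_ifs
  · refine Finset.measurable_prod _ fun t _ => ?_
    split_ifs <;> fun_prop
  · exact measurable_const

lemma typeWeight_nonneg (G : SimpleGraph V) [DecidableRel G.Adj] (v0 : V) (e0 : Sym2 V) {T : ℕ}
    (x : Fin (T + 1) → V) : 0 ≤ typeWeight G v0 e0 x := by
  unfold typeWeight
  split_ifs <;> positivity

/-- Mutual-information bound.  Let `W ∼ μ_{v0,A}` and, conditional on
`W = w`, let `X_0^T` be the quenched path of `P_w` started at `v0`.  Then the mutual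
information `I(W; X_0^T) = D(law(W, X_0^T) ‖ law(W) ⊗ law(X_0^T))` satisfies
`I(W; X_0^T) ≤ (2|E| − 1)·log(T+1)`. -/
theorem mutual_information_bound
    {V : Type*} [Fintype V] [DecidableEq V] [MeasurableSpace V] [DiscreteMeasurableSpace V]
    (G : SimpleGraph V) [DecidableRel G.Adj] (hG : G.Connected)
    (v0 : V) (e0 : Sym2 V) (he0 : e0 ∈ G.edgeFinset)
    (a : Sym2 V → ℝ) (ha : ∀ e ∈ G.edgeFinset, 0 < a e)
    (T : ℕ) (hT : 1 ≤ T)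
    -- the joint law of `(W, X_0^T)`
    (J : Measure ((Sym2 V → ℝ) × (Fin (T + 1) → V)))
    (hJ : J = ∑ x : Fin (T + 1) → V,
        ((mixing G e0 v0 a).withDensity fun w =>
            ENNReal.ofReal (quenchedProb G v0 w T x)).map (fun w => (w, x))) :
    KL J ((J.map Prod.fst).prod (J.map Prod.snd)) ≤
      (((2 * (G.edgeFinset.card : ℝ) - 1) * Real.log (T + 1) : ℝ) : EReal) := by
  have hadj := exists_adj_of_connected hG he0
  have hT' : (1 : ℝ) ≤ (T : ℝ) + 1 := by
    have := T.cast_nonneg (α := ℝ)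
    linarith
  have hpos := ae_mixing_pos (e0 := e0) G v0 a
  refine (KL_joint_le (mixing_univ_le_one G v0 hadj he0 a ha)
    (fun x => measurable_quenchedProb G v0 x) ?_ ?_ (typeWeight G v0 e0) ?_
    (fun x => typeWeight_nonneg G v0 e0 x) (one_le_pow₀ hT') (sum_typeWeight_le G he0 v0 T)
    hJ).trans ?_
  · filter_upwards [hpos] with w hw x using quenchedProb_nonneg G x hw
  · filter_upwards [hpos] with w hw using
      sum_quenchedProb G v0 w (fun i => (vw_pos G hadj hw i).ne') T
  · filter_upwards [hpos] with w hw x using quenchedProb_le_typeWeight G hadj he0 v0 x hw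
  · rw [EReal.coe_le_coe_iff]
    have hE : 1 ≤ G.edgeFinset.card := Finset.card_pos.2 ⟨e0, he0⟩
    have hE' : (1 : ℝ) ≤ G.edgeFinset.card := by exact_mod_cast hE
    have hlog : log 2 ≤ log ((T : ℝ) + 1) := by
      refine log_le_log two_pos ?_
      have : (1 : ℝ) ≤ T := by exact_mod_cast hT
      linarith
    have hlog2 := log_two_gt_d9
    rw [log_pow, Nat.cast_sub hE, Nat.cast_one]
    nlinarith

end ERRW
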